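/- arXiv:2605.23291 — 4 statements merged into one kernel-verified Lean document; each statement's English description precedes it below -/
import Mathlib

section
/- Let M be a matroid on a finite ground set E and let K be an integer with 1 ≤ K ≤ rank(M). Define the degree-K independent-set generating polynomial f_{M,K}(x) = Σ_{S independent in M, |S| = K} Π_{e ∈ S} x_e for x ∈ ℝ^E. Then the function h_{M,K}(x) = f_{M,K}(x)^{1/K} is concave on the nonnegative orthant ℝ_{≥0}^E. -/
open Finset Classical

/-- The degree-`K` independent-set generating polynomial of a matroid `M` on a finite
ground set `α`: `f_{M,K}(x) = ∑_{S ∈ I(M), |S| = K} ∏_{e ∈ S} x_e`. -/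
noncomputable def indepGenPoly {α : Type*} [Fintype α] (M : Matroid α) (K : ℕ)
    (x : α → ℝ) : ℝ :=
  ∑ S ∈ Finset.univ.powersetCard K, if M.Indep (S : Set α) then ∏ e ∈ S, x e else 0


open Matrix

section LorentzianForms

variable {ι : Type*} [Fintype ι]

theorem Matrix.IsSymm.dotProduct_mulVec_comm {A : Matrix ι ι ℝ} (hA : A.IsSymm) (v w : ι → ℝ) :
    v ⬝ᵥ A *ᵥ w = w ⬝ᵥ A *ᵥ v := by
  rw [dotProduct_mulVec, ← mulVec_transpose, hA.eq, dotProduct_comm]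

/-- The quadratic form of `A` satisfies the reversed Cauchy–Schwarz inequality against `x`. -/
def LorentzianAt (A : Matrix ι ι ℝ) (x : ι → ℝ) : Prop :=
  ∀ v : ι → ℝ, (v ⬝ᵥ A *ᵥ v) * (x ⬝ᵥ A *ᵥ x) ≤ (v ⬝ᵥ A *ᵥ x) ^ 2

theorem lorentzianAt_of_orthogonal {A : Matrix ι ι ℝ} (hA : A.IsSymm) {x : ι → ℝ}
    (hx : 0 ≤ x ⬝ᵥ A *ᵥ x)
    (h : 0 < x ⬝ᵥ A *ᵥ x → ∀ v, v ⬝ᵥ A *ᵥ x = 0 → v ⬝ᵥ A *ᵥ v ≤ 0) : LorentzianAt A x := by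
  intro v
  rcases hx.eq_or_lt with h0 | h0
  · rw [← h0, mul_zero]
    positivity
  · set q := x ⬝ᵥ A *ᵥ x
    set b := v ⬝ᵥ A *ᵥ x
    have hb : x ⬝ᵥ A *ᵥ v = b := hA.dotProduct_mulVec_comm x v
    have key := h h0 (q • v - b • x) (by
      simp only [sub_dotProduct, smul_dotProduct, smul_eq_mul]
      ring)
    simp only [sub_dotProduct, smul_dotProduct, mulVec_sub, mulVec_smul, dotProduct_sub,
      dotProduct_smul, smul_eq_mul, hb] at key
    have : q * ((v ⬝ᵥ A *ᵥ v) * q - b ^ 2) ≤ 0 := by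
      linarith [key, show q * (q * v ⬝ᵥ A *ᵥ v - b * b) - b * (q * b - b * q)
        = q * ((v ⬝ᵥ A *ᵥ v) * q - b ^ 2) by ring]
    by_contra! hlt
    nlinarith [mul_pos h0 (sub_pos.2 hlt)]

/-- If the quadratic form of `D - A` vanishes only on the span of `y`, a kernel vector of `D - A`,
then the range of `D - A` contains every vector orthogonal to `y`. -/
theorem exists_sub_mulVec_eq {A : Matrix ι ι ℝ} (hA : A.IsSymm) {D y : ι → ℝ} (hy : y ≠ 0)
    (hAy : A *ᵥ y = D * y)
    (heq : ∀ v, v ⬝ᵥ A *ᵥ v = v ⬝ᵥ (D * v) → ∃ c : ℝ, v = c • y)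
    {u : ι → ℝ} (hu : y ⬝ᵥ u = 0) : ∃ w, D * w - A *ᵥ w = u := by
  have hyy : 0 < y ⬝ᵥ y := by
    refine lt_of_le_of_ne (Finset.sum_nonneg fun i _ => mul_self_nonneg _) fun h => hy ?_
    exact dotProduct_self_eq_zero.1 h.symm
  have hyL (w : ι → ℝ) : y ⬝ᵥ (D * w - A *ᵥ w) = 0 := by
    rw [dotProduct_sub, hA.dotProduct_mulVec_comm, hAy, sub_eq_zero]
    simp only [dotProduct, Pi.mul_apply]
    exact Finset.sum_congr rfl fun i _ => by ring
  let L : (ι → ℝ) →ₗ[ℝ] (ι → ℝ) :=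
    { toFun := fun w => D * w - A *ᵥ w + (y ⬝ᵥ w) • y
      map_add' := fun a b => by
        rw [mulVec_add, dotProduct_add, mul_add, add_smul]
        abel
      map_smul' := fun c a => by
        ext i
        simp only [mulVec_smul, dotProduct_smul, Pi.add_apply, Pi.sub_apply, Pi.mul_apply,
          Pi.smul_apply, smul_eq_mul, RingHom.id_apply]
        ring }
  have hL (w : ι → ℝ) : L w = D * w - A *ᵥ w + (y ⬝ᵥ w) • y := rfl
  have hinj : Function.Injective L := by
    rw [injective_iff_map_eq_zero]
    intro w hw
    rw [hL] at hw
    have h1 : y ⬝ᵥ w = 0 := by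
      have := congrArg (y ⬝ᵥ ·) hw
      simp only [dotProduct_add, hyL, dotProduct_smul, smul_eq_mul, dotProduct_zero,
        zero_add] at this
      exact (mul_eq_zero.1 this).resolve_right hyy.ne'
    rw [h1, zero_smul, add_zero, sub_eq_zero] at hw
    obtain ⟨c, rfl⟩ := heq w (by rw [hw])
    rw [dotProduct_smul, smul_eq_mul] at h1
    rw [(mul_eq_zero.1 h1).resolve_right hyy.ne', zero_smul]
  obtain ⟨w, hw⟩ := LinearMap.injective_iff_surjective.1 hinj u
  rw [hL] at hw
  refine ⟨w, ?_⟩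
  have h1 : y ⬝ᵥ w = 0 := by
    have := congrArg (y ⬝ᵥ ·) hw
    simp only [dotProduct_add, hyL, dotProduct_smul, smul_eq_mul, hu, zero_add] at this
    exact (mul_eq_zero.1 this).resolve_right hyy.ne'
  rwa [h1, zero_smul, add_zero] at hw

/-- If `B = D⁻¹ A` satisfies `B ≤ B²` and `B ≤ 1`, with `B = 1` only along `y`, then `A` is
negative semidefinite on the orthogonal complement of `A y`. -/
theorem dotProduct_mulVec_nonpos_of_le_sq {A : Matrix ι ι ℝ} (hA : A.IsSymm) {D y : ι → ℝ}
    (hD : ∀ i, 0 < D i) (hy : y ≠ 0) (hAy : A *ᵥ y = D * y)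
    (hsq : ∀ v, v ⬝ᵥ A *ᵥ v ≤ ∑ i, (A *ᵥ v) i ^ 2 / D i)
    (hle : ∀ v, v ⬝ᵥ A *ᵥ v ≤ v ⬝ᵥ (D * v))
    (heq : ∀ v, v ⬝ᵥ A *ᵥ v = v ⬝ᵥ (D * v) → ∃ c : ℝ, v = c • y)
    {v : ι → ℝ} (hv : v ⬝ᵥ A *ᵥ y = 0) : v ⬝ᵥ A *ᵥ v ≤ 0 := by
  have hu : y ⬝ᵥ (D * v) = 0 := by
    rw [← hv, hAy]
    simp only [dotProduct, Pi.mul_apply]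
    exact Finset.sum_congr rfl fun i _ => by ring
  obtain ⟨w, hw⟩ := exists_sub_mulVec_eq hA hy hAy heq hu
  have hAw : A *ᵥ w = D * w - D * v := by rw [← hw]; abel
  have h1 := hsq w
  have h2 : ∑ i, (A *ᵥ w) i ^ 2 / D i =
      w ⬝ᵥ (D * w) - 2 * (w ⬝ᵥ (D * v)) + v ⬝ᵥ (D * v) := by
    simp only [hAw, dotProduct, Finset.mul_sum, ← Finset.sum_sub_distrib,
      ← Finset.sum_add_distrib]
    refine Finset.sum_congr rfl fun i _ => ?_
    have := (hD i).ne'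
    simp only [Pi.sub_apply, Pi.mul_apply]
    field_simp
    ring
  have h3 := hle (v - w)
  have h4 : (v - w) ⬝ᵥ (D * (v - w)) =
      w ⬝ᵥ (D * w) - 2 * (w ⬝ᵥ (D * v)) + v ⬝ᵥ (D * v) := by
    simp only [dotProduct, Finset.mul_sum, ← Finset.sum_sub_distrib,
      ← Finset.sum_add_distrib]
    refine Finset.sum_congr rfl fun i _ => ?_
    simp only [Pi.sub_apply, Pi.mul_apply]
    ring
  have h5 : v ⬝ᵥ (D * w) = w ⬝ᵥ (D * v) := by
    simp only [dotProduct, Pi.mul_apply]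
    exact Finset.sum_congr rfl fun i _ => by ring
  rw [mulVec_sub, sub_dotProduct, dotProduct_sub, dotProduct_sub,
    hA.dotProduct_mulVec_comm w v, hAw, dotProduct_sub, dotProduct_sub, h5] at h3
  rw [hAw, dotProduct_sub] at h1
  rw [hAw] at h2
  linarith

/-- A nonnegative symmetric matrix is dominated by its row sums. -/
theorem sum_rowSum_sub_dotProduct_mulVec {A : Matrix ι ι ℝ} (hA : A.IsSymm) {x : ι → ℝ}
    (hx : ∀ i, 0 < x i) (v : ι → ℝ) :
    ∑ i, (A *ᵥ x) i / x i * v i ^ 2 - v ⬝ᵥ A *ᵥ v =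
      (∑ i, ∑ j, A i j * (x i * x j * (v i / x i - v j / x j) ^ 2)) / 2 := by
  have h1 : ∑ i, ∑ j, A i j * (x j / x i) * v i ^ 2 = ∑ i, (A *ᵥ x) i / x i * v i ^ 2 := by
    refine Finset.sum_congr rfl fun i _ => ?_
    simp only [mulVec, dotProduct, Finset.sum_div, Finset.sum_mul]
    exact Finset.sum_congr rfl fun j _ => by ring
  have h2 : ∑ i, ∑ j, A i j * (x i / x j) * v j ^ 2 = ∑ i, (A *ᵥ x) i / x i * v i ^ 2 := by
    rw [Finset.sum_comm, ← h1]
    exact Finset.sum_congr rfl fun i _ => Finset.sum_congr rfl fun j _ => by rw [hA.apply]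
  have h3 : v ⬝ᵥ A *ᵥ v = ∑ i, ∑ j, A i j * (v i * v j) := by
    simp only [mulVec, dotProduct, Finset.mul_sum]
    exact Finset.sum_congr rfl fun i _ => Finset.sum_congr rfl fun j _ => by ring
  have h4 : ∑ i, ∑ j, A i j * (x i * x j * (v i / x i - v j / x j) ^ 2) =
      ∑ i, ∑ j, A i j * (x j / x i) * v i ^ 2 + ∑ i, ∑ j, A i j * (x i / x j) * v j ^ 2
        - 2 * ∑ i, ∑ j, A i j * (v i * v j) := by
    simp only [Finset.mul_sum, ← Finset.sum_sub_distrib, ← Finset.sum_add_distrib]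
    refine Finset.sum_congr rfl fun i _ => Finset.sum_congr rfl fun j _ => ?_
    have := (hx i).ne'
    have := (hx j).ne'
    field_simp
    ring
  rw [h4, h1, h2, h3]
  ring

theorem dotProduct_mulVec_nonneg {A : Matrix ι ι ℝ} (hA : ∀ i j, 0 ≤ A i j) {x : ι → ℝ}
    (hx : ∀ i, 0 < x i) : 0 ≤ x ⬝ᵥ A *ᵥ x :=
  Finset.sum_nonneg fun i _ => mul_nonneg (hx i).le <|
    Finset.sum_nonneg fun j _ => mul_nonneg (hA i j) (hx j).le

theorem apply_eq_zero_of_mulVec_apply_eq_zero {A : Matrix ι ι ℝ} (hA : ∀ i j, 0 ≤ A i j)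
    {x : ι → ℝ} (hx : ∀ i, 0 < x i) {i : ι} (h : (A *ᵥ x) i = 0) (j : ι) : A i j = 0 := by
  have := (Finset.sum_eq_zero_iff_of_nonneg fun j _ => mul_nonneg (hA i j) (hx j).le).1 h j
    (Finset.mem_univ j)
  exact (mul_eq_zero.1 this).resolve_right (hx j).ne'

/-- **Local-to-global principle.** If `A = ∑ e, x e • B e`, where each `B e` is Lorentzian at `x`
and `B e *ᵥ x` is the row `e` of `A`, and the support graph of `A` is connected on the indices
with a nonzero row, then `A` is Lorentzian at `x`. -/
theorem lorentzianAt_of_links {A : Matrix ι ι ℝ} (hA : A.IsSymm) (hA0 : ∀ i j, 0 ≤ A i j)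
    {x : ι → ℝ} (hx : ∀ i, 0 < x i) (B : ι → Matrix ι ι ℝ) (hB0 : ∀ e i j, 0 ≤ B e i j)
    (hAB : A = ∑ e, x e • B e) (hBx : ∀ e, B e *ᵥ x = A e) (hB : ∀ e, LorentzianAt (B e) x)
    (hconn : ∀ w : ι → ℝ, (∀ i j, A i j ≠ 0 → w i = w j) →
      ∀ i j, (A *ᵥ x) i ≠ 0 → (A *ᵥ x) j ≠ 0 → w i = w j) : LorentzianAt A x := by
  refine lorentzianAt_of_orthogonal hA (dotProduct_mulVec_nonneg hA0 hx) fun hpos v hv => ?_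
  set D : ι → ℝ := fun i => if (A *ᵥ x) i = 0 then 1 else (A *ᵥ x) i / x i with hDdef
  set y : ι → ℝ := fun i => if (A *ᵥ x) i = 0 then 0 else x i with hydef
  have hAx0 (i : ι) : 0 ≤ (A *ᵥ x) i :=
    Finset.sum_nonneg fun j _ => mul_nonneg (hA0 i j) (hx j).le
  have hD (i : ι) : 0 < D i := by
    simp only [hDdef]
    split_ifs with h
    · exact one_pos
    · exact div_pos ((hAx0 i).lt_of_ne' h) (hx i)
  have hrow {i : ι} (h : (A *ᵥ x) i = 0) (j : ι) : A i j = 0 :=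
    apply_eq_zero_of_mulVec_apply_eq_zero hA0 hx h j
  have hAyx : A *ᵥ y = A *ᵥ x := by
    ext i
    refine Finset.sum_congr rfl fun j _ => ?_
    simp only [hydef]
    split_ifs with h
    · rw [← hA.apply, hrow h, zero_mul, zero_mul]
    · rfl
  have hAy : A *ᵥ y = D * y := by
    rw [hAyx]
    ext i
    simp only [hDdef, hydef, Pi.mul_apply]
    split_ifs with h
    · simp [h]
    · rw [div_mul_cancel₀ _ (hx i).ne']
  have hy : y ≠ 0 := by
    rintro h
    rw [← hAyx, h, mulVec_zero, dotProduct_zero] at hpos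
    exact lt_irrefl _ hpos
  have hgap (v : ι → ℝ) : v ⬝ᵥ (D * v) - v ⬝ᵥ A *ᵥ v =
      (∑ i, if (A *ᵥ x) i = 0 then v i ^ 2 else 0) +
      (∑ i, ∑ j, A i j * (x i * x j * (v i / x i - v j / x j) ^ 2)) / 2 := by
    rw [← sum_rowSum_sub_dotProduct_mulVec hA hx, ← add_sub_assoc, ← Finset.sum_add_distrib]
    congr 1
    refine Finset.sum_congr rfl fun i _ => ?_
    simp only [hDdef, Pi.mul_apply]
    split_ifs with h
    · rw [h]
      ring
    · ring
  have hterm (v : ι → ℝ) (i j : ι) :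
      0 ≤ A i j * (x i * x j * (v i / x i - v j / x j) ^ 2) :=
    mul_nonneg (hA0 i j) (mul_nonneg (mul_pos (hx i) (hx j)).le (sq_nonneg _))
  have hs1 (v : ι → ℝ) (i : ι) : 0 ≤ if (A *ᵥ x) i = 0 then v i ^ 2 else 0 := by
    split_ifs
    · exact sq_nonneg _
    · exact le_rfl
  have hS1 (v : ι → ℝ) : 0 ≤ ∑ i, if (A *ᵥ x) i = 0 then v i ^ 2 else 0 :=
    Finset.sum_nonneg fun i _ => hs1 v i
  have hS2 (v : ι → ℝ) : 0 ≤ ∑ i, ∑ j, A i j * (x i * x j * (v i / x i - v j / x j) ^ 2) :=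
    Finset.sum_nonneg fun i _ => Finset.sum_nonneg fun j _ => hterm v i j
  refine dotProduct_mulVec_nonpos_of_le_sq hA hD hy hAy ?_ ?_ ?_ (by rwa [hAyx])
  · intro v
    have hvAv : v ⬝ᵥ A *ᵥ v = ∑ e, x e * (v ⬝ᵥ B e *ᵥ v) := by
      conv_lhs => rw [hAB]
      rw [sum_mulVec, dotProduct_sum]
      exact Finset.sum_congr rfl fun e _ => by
        rw [smul_mulVec, dotProduct_smul, smul_eq_mul]
    rw [hvAv]
    refine Finset.sum_le_sum fun e _ => ?_
    have hlor := hB e v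
    rw [hBx] at hlor
    have hcomm : v ⬝ᵥ A e = (A *ᵥ v) e := dotProduct_comm _ _
    have hcomm' : x ⬝ᵥ A e = (A *ᵥ x) e := dotProduct_comm _ _
    rw [hcomm, hcomm'] at hlor
    by_cases h : (A *ᵥ x) e = 0
    · have hBe (i : ι) : (B e *ᵥ x) i = 0 := by rw [hBx]; exact hrow h i
      have : v ⬝ᵥ B e *ᵥ v = 0 := by
        refine Finset.sum_eq_zero fun i _ => ?_
        have : (B e *ᵥ v) i = 0 := Finset.sum_eq_zero fun j _ => mul_eq_zero_of_left
          (apply_eq_zero_of_mulVec_apply_eq_zero (hB0 e) hx (hBe i) j) _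
        rw [this, mul_zero]
      rw [this, mul_zero]
      exact div_nonneg (sq_nonneg _) (hD e).le
    · have hp : 0 < (A *ᵥ x) e := (hAx0 e).lt_of_ne' h
      simp only [hDdef, if_neg h]
      rw [div_div_eq_mul_div, le_div_iff₀ hp]
      nlinarith [hx e]
  · intro v
    linarith [hgap v, hS1 v, hS2 v]
  · intro v hv
    have h0 := hgap v
    rw [hv, sub_self] at h0
    have e1 : ∑ i, (if (A *ᵥ x) i = 0 then v i ^ 2 else 0) = 0 := by
      linarith [hS1 v, hS2 v]
    have e2 : ∑ i, ∑ j, A i j * (x i * x j * (v i / x i - v j / x j) ^ 2) = 0 := by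
      linarith [hS1 v, hS2 v]
    have hv0 (i : ι) (hi : (A *ᵥ x) i = 0) : v i = 0 := by
      have := (Finset.sum_eq_zero_iff_of_nonneg fun i _ => hs1 v i).1 e1 i (Finset.mem_univ i)
      rw [if_pos hi] at this
      exact pow_eq_zero_iff two_ne_zero |>.1 this
    have hedge (i j : ι) (hij : A i j ≠ 0) : v i / x i = v j / x j := by
      have h1 := (Finset.sum_eq_zero_iff_of_nonneg fun i _ =>
        Finset.sum_nonneg fun j _ => hterm v i j).1 e2 i (Finset.mem_univ i)
      have h2 := (Finset.sum_eq_zero_iff_of_nonneg fun j _ => hterm v i j).1 h1 j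
        (Finset.mem_univ j)
      have h3 := (mul_eq_zero.1 h2).resolve_left hij
      have h4 := (mul_eq_zero.1 h3).resolve_left (mul_pos (hx i) (hx j)).ne'
      exact sub_eq_zero.1 (pow_eq_zero_iff two_ne_zero |>.1 h4)
    have hratio := hconn (fun i => v i / x i) hedge
    obtain ⟨k, hk⟩ : ∃ k, (A *ᵥ x) k ≠ 0 := by
      by_contra! h
      apply hy
      ext i
      simp [hydef, h i]
    refine ⟨v k / x k, ?_⟩
    ext i
    simp only [Pi.smul_apply, smul_eq_mul, hydef]
    split_ifs with h
    · rw [hv0 i h, mul_zero]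
    · rw [← hratio i k h hk, div_mul_cancel₀ _ (hx i).ne']

end LorentzianForms

section TupleSum

variable {α : Type*} [Fintype α]

/-- `tupleSum c x k T` is the sum over all `k`-tuples `(e₁, …, e_k)` of
`c ({e₁, …, e_k} + T) * x e₁ * ⋯ * x e_k`. -/
noncomputable def tupleSum (c : Multiset α → ℝ) (x : α → ℝ) : ℕ → Multiset α → ℝ
  | 0, T => c T
  | k + 1, T => ∑ e, x e * tupleSum c x k (e ::ₘ T)

/-- The matrix of second-order derivatives of `tupleSum c x (k + 2) T`, divided by
`(k + 2) * (k + 1)`. -/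
noncomputable def tupleHess (c : Multiset α → ℝ) (x : α → ℝ) (k : ℕ) (T : Multiset α) :
    Matrix α α ℝ :=
  Matrix.of fun e f => tupleSum c x k (e ::ₘ f ::ₘ T)

variable {c : Multiset α → ℝ} {x : α → ℝ}

theorem tupleHess_apply (k : ℕ) (T : Multiset α) (e f : α) :
    tupleHess c x k T e f = tupleSum c x k (e ::ₘ f ::ₘ T) := rfl

theorem tupleHess_isSymm (k : ℕ) (T : Multiset α) : (tupleHess c x k T).IsSymm := by
  ext e f
  rw [transpose_apply, tupleHess_apply, tupleHess_apply, Multiset.cons_swap]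

theorem tupleHess_mulVec_self (k : ℕ) (T : Multiset α) (e : α) :
    (tupleHess c x k T *ᵥ x) e = tupleSum c x (k + 1) (e ::ₘ T) := by
  simp only [mulVec, dotProduct, tupleHess_apply, tupleSum]
  refine Finset.sum_congr rfl fun f _ => ?_
  rw [Multiset.cons_swap, mul_comm]

theorem dotProduct_tupleHess_mulVec_self (k : ℕ) (T : Multiset α) (v : α → ℝ) :
    v ⬝ᵥ tupleHess c x k T *ᵥ x = ∑ e, v e * tupleSum c x (k + 1) (e ::ₘ T) :=
  Finset.sum_congr rfl fun e _ => by rw [tupleHess_mulVec_self]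

theorem tupleSum_nonneg (hc : ∀ T, 0 ≤ c T) (hx : ∀ e, 0 ≤ x e) (k : ℕ) (T : Multiset α) :
    0 ≤ tupleSum c x k T := by
  induction k generalizing T with
  | zero => exact hc T
  | succ k ih => exact Finset.sum_nonneg fun e _ => mul_nonneg (hx e) (ih _)

/-- The Lorentzian property of the links of `T` implies that of `T`. -/
theorem lorentzianAt_tupleHess_succ (hc : ∀ T, 0 ≤ c T) (hx : ∀ e, 0 < x e) (k : ℕ)
    (T : Multiset α) (hlink : ∀ e, LorentzianAt (tupleHess c x k (e ::ₘ T)) x)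
    (hconn : ∀ w : α → ℝ, (∀ e f, tupleSum c x (k + 1) (e ::ₘ f ::ₘ T) ≠ 0 → w e = w f) →
      ∀ e f, tupleSum c x (k + 2) (e ::ₘ T) ≠ 0 → tupleSum c x (k + 2) (f ::ₘ T) ≠ 0 →
        w e = w f) :
    LorentzianAt (tupleHess c x (k + 1) T) x := by
  have h0 (k : ℕ) (T : Multiset α) (i j : α) : 0 ≤ tupleHess c x k T i j :=
    tupleSum_nonneg hc (fun e => (hx e).le) _ _
  refine lorentzianAt_of_links (tupleHess_isSymm _ _) (h0 _ _) hx
    (fun e => tupleHess c x k (e ::ₘ T)) (fun e => h0 _ _) ?_ ?_ hlink ?_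
  · ext i j
    simp only [Matrix.sum_apply, Matrix.smul_apply, tupleHess_apply, smul_eq_mul, tupleSum]
    refine Finset.sum_congr rfl fun e _ => ?_
    rw [Multiset.cons_swap e i, Multiset.cons_swap e j]
  · intro e
    ext i
    rw [tupleHess_mulVec_self, tupleHess_apply, Multiset.cons_swap]
  · intro w hw e f he hf
    rw [tupleHess_mulVec_self] at he hf
    exact hconn w hw e f he hf

theorem hasDerivAt_tupleSum (c : Multiset α → ℝ) (x v : α → ℝ) (k : ℕ) (T : Multiset α) (t : ℝ) :
    HasDerivAt (fun t : ℝ => tupleSum c (x + t • v) (k + 1) T)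
      ((k + 1) * ∑ e, v e * tupleSum c (x + t • v) k (e ::ₘ T)) t := by
  have hx (e : α) : HasDerivAt (fun t : ℝ => (x + t • v) e) (v e) t := by
    simpa using ((hasDerivAt_id t).mul_const (v e)).const_add (x e)
  induction k generalizing T with
  | zero =>
    have := HasDerivAt.fun_sum (u := Finset.univ) fun e _ => (hx e).mul_const (c (e ::ₘ T))
    simpa [tupleSum] using this
  | succ k ih =>
    have := HasDerivAt.fun_sum (u := Finset.univ) fun e _ => (hx e).mul (ih (e ::ₘ T))
    refine this.congr_deriv ?_
    rw [Finset.sum_add_distrib]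
    have hswap : ∑ e, (x + t • v) e *
        (((k : ℝ) + 1) * ∑ g, v g * tupleSum c (x + t • v) k (g ::ₘ e ::ₘ T)) =
        (k + 1) * ∑ g, v g * tupleSum c (x + t • v) (k + 1) (g ::ₘ T) := by
      simp only [tupleSum, Finset.mul_sum]
      rw [Finset.sum_comm]
      refine Finset.sum_congr rfl fun g _ => Finset.sum_congr rfl fun e _ => ?_
      rw [Multiset.cons_swap]
      ring
    rw [hswap]
    push_cast
    ring

theorem sum_sum_powersetCard_erase (h : Finset α → ℝ) (k : ℕ) :
    ∑ e, ∑ S ∈ (Finset.univ.erase e).powersetCard k, h (insert e S) =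
      (k + 1) * ∑ S ∈ (Finset.univ : Finset α).powersetCard (k + 1), h S := by
  have h1 : ∑ S ∈ (Finset.univ : Finset α).powersetCard (k + 1), ∑ _e ∈ S, h S =
      (k + 1) * ∑ S ∈ (Finset.univ : Finset α).powersetCard (k + 1), h S := by
    rw [Finset.mul_sum]
    refine Finset.sum_congr rfl fun S hS => ?_
    rw [Finset.sum_const, (Finset.mem_powersetCard.1 hS).2, nsmul_eq_mul]
    push_cast
    rfl
  rw [← h1, Finset.sum_sigma', Finset.sum_sigma']
  refine Finset.sum_bij' (fun p _ => ⟨insert p.1 p.2, p.1⟩) (fun p _ => ⟨p.2, p.1.erase p.2⟩)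
    ?_ ?_ ?_ ?_ ?_
  · rintro ⟨e, S⟩ hS
    simp only [Finset.mem_sigma, Finset.mem_univ, true_and, Finset.mem_powersetCard,
      Finset.subset_univ, Finset.subset_erase] at hS ⊢
    exact ⟨by rw [Finset.card_insert_of_notMem hS.1, hS.2], Finset.mem_insert_self _ _⟩
  · rintro ⟨S, e⟩ hS
    simp only [Finset.mem_sigma, Finset.mem_univ, true_and, Finset.mem_powersetCard,
      Finset.subset_univ, Finset.subset_erase] at hS ⊢
    exact ⟨Finset.notMem_erase _ _, by rw [Finset.card_erase_of_mem hS.2, hS.1]; rfl⟩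
  · rintro ⟨e, S⟩ hS
    simp only [Finset.mem_sigma, Finset.mem_univ, true_and, Finset.mem_powersetCard,
      Finset.subset_erase, Finset.subset_univ] at hS
    simp [Finset.erase_insert hS.1]
  · rintro ⟨S, e⟩ hS
    simp only [Finset.mem_sigma] at hS
    simp [Finset.insert_erase hS.2]
  · rintro ⟨e, S⟩ _
    rfl

theorem tupleSum_eq_factorial_mul (hc : ∀ T, ¬ T.Nodup → c T = 0) (k : ℕ) (T : Multiset α) :
    tupleSum c x k T = k.factorial *
      ∑ S ∈ (Finset.univ : Finset α).powersetCard k, c (S.val + T) * ∏ e ∈ S, x e := by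
  induction k generalizing T with
  | zero => simp [tupleSum]
  | succ k ih =>
    have key (e : α) : x e * tupleSum c x k (e ::ₘ T) = k.factorial *
        ∑ S ∈ (Finset.univ.erase e).powersetCard k,
          c ((insert e S).val + T) * ∏ i ∈ insert e S, x i := by
      rw [ih, mul_left_comm, Finset.mul_sum]
      congr 1
      rw [← Finset.sum_subset (Finset.powersetCard_mono (Finset.erase_subset e Finset.univ))]
      · refine Finset.sum_congr rfl fun S hS => ?_
        have he : e ∉ S := (Finset.subset_erase.1 (Finset.mem_powersetCard.1 hS).1).2
        rw [Finset.prod_insert he, Finset.insert_val_of_notMem he, Multiset.cons_add,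
          Multiset.add_cons]
        ring
      · intro S hS hS'
        have he : e ∈ S := by
          by_contra he
          exact hS' (Finset.mem_powersetCard.2 ⟨Finset.subset_erase.2
            ⟨Finset.subset_univ S, he⟩, (Finset.mem_powersetCard.1 hS).2⟩)
        rw [hc, zero_mul, mul_zero]
        rw [Multiset.add_cons, Multiset.nodup_cons, Multiset.mem_add]
        exact fun h => h.1 (Or.inl he)
    simp only [tupleSum, key]
    rw [← Finset.mul_sum, sum_sum_powersetCard_erase
      (fun S => c (S.val + T) * ∏ i ∈ S, x i), Nat.factorial_succ]
    push_cast
    ring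

end TupleSum

section Independence

variable {α : Type*} {M : Matroid α}

/-- A multiset is an independent set of `M` if it has no repetition and its support is
independent in `M`. -/
def Matroid.MultisetIndep (M : Matroid α) (T : Multiset α) : Prop :=
  T.Nodup ∧ M.Indep {e | e ∈ T}

theorem Matroid.MultisetIndep.subset {S T : Multiset α} (hT : M.MultisetIndep T) (h : S ≤ T) :
    M.MultisetIndep S :=
  ⟨Multiset.nodup_of_le h hT.1, hT.2.subset fun _ he => Multiset.mem_of_le h he⟩

theorem setOf_mem_cons (e : α) (T : Multiset α) :
    {a | a ∈ e ::ₘ T} = insert e {a | a ∈ T} := by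
  ext a
  simp

theorem Matroid.multisetIndep_cons {e : α} {T : Multiset α} :
    M.MultisetIndep (e ::ₘ T) ↔ e ∉ T ∧ T.Nodup ∧ M.Indep (insert e {a | a ∈ T}) := by
  rw [Matroid.MultisetIndep, Multiset.nodup_cons, setOf_mem_cons, and_assoc]

theorem encard_setOf_mem {T : Multiset α} (hT : T.Nodup) :
    {e | e ∈ T}.encard = Multiset.card T := by
  rw [← Multiset.toFinset_card_of_nodup hT, ← Set.encard_coe_eq_coe_finsetCard]
  congr 1
  ext e
  simp

theorem Matroid.MultisetIndep.augment {S T : Multiset α} (hS : M.MultisetIndep S)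
    (hT : M.MultisetIndep T) (h : Multiset.card S < Multiset.card T) :
    ∃ e ∈ T, M.MultisetIndep (e ::ₘ S) := by
  obtain ⟨e, ⟨heT, heS⟩, he⟩ := hS.2.augment hT.2 (by
    rw [encard_setOf_mem hS.1, encard_setOf_mem hT.1]
    exact_mod_cast h)
  exact ⟨e, heT, Matroid.multisetIndep_cons.2 ⟨heS, hS.1, he⟩⟩

/-- In an independent extension of `T`, two elements fail to extend `T` jointly exactly when they
are parallel over `T`. -/
theorem Matroid.multisetIndep_cons_cons_iff (hE : M.E = Set.univ) {e f : α} {T : Multiset α}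
    (he : M.MultisetIndep (e ::ₘ T)) (hf : M.MultisetIndep (f ::ₘ T)) :
    M.MultisetIndep (e ::ₘ f ::ₘ T) ↔
      M.closure (insert e {a | a ∈ T}) ≠ M.closure (insert f {a | a ∈ T}) := by
  have hmem {e f : α} (he : M.MultisetIndep (e ::ₘ T)) (hf : M.MultisetIndep (f ::ₘ T)) :
      M.MultisetIndep (e ::ₘ f ::ₘ T) ↔ e ∉ M.closure (insert f {a | a ∈ T}) := by
    have hf' : M.Indep (insert f {a | a ∈ T}) := (Matroid.multisetIndep_cons.1 hf).2.2
    rw [Matroid.multisetIndep_cons, setOf_mem_cons, hf'.mem_closure_iff', hE]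
    have h1 : e ∈ f ::ₘ T ↔ e ∈ insert f {a | a ∈ T} := by simp
    rw [h1]
    have := hf.1
    simp only [Set.mem_univ, true_and]
    tauto
  have hsub {e f : α} (h : e ∈ M.closure (insert f {a | a ∈ T})) :
      M.closure (insert e {a | a ∈ T}) ⊆ M.closure (insert f {a | a ∈ T}) := by
    refine M.closure_subset_closure_of_subset_closure (Set.insert_subset h ?_)
    exact fun a ha => M.mem_closure_of_mem' (Or.inr ha) (hE ▸ Set.mem_univ a)
  constructor
  · intro h heq
    refine (hmem he hf).1 h ?_
    rw [← heq]
    exact M.mem_closure_of_mem' (Or.inl rfl) (hE ▸ Set.mem_univ e)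
  · intro h
    by_contra hdep
    refine h (Set.Subset.antisymm (hsub ?_) (hsub ?_))
    · by_contra hcon
      exact hdep ((hmem he hf).2 hcon)
    · by_contra hcon
      rw [Multiset.cons_swap] at hdep
      exact hdep ((hmem hf he).2 hcon)

/-- The indicator function of the independent multisets. -/
noncomputable def Matroid.indepIndicator (M : Matroid α) (T : Multiset α) : ℝ :=
  if M.MultisetIndep T then 1 else 0

theorem Matroid.indepIndicator_nonneg (T : Multiset α) : 0 ≤ M.indepIndicator T := by
  unfold Matroid.indepIndicator
  split_ifs <;> norm_num

variable [Fintype α] {x : α → ℝ}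

theorem Matroid.tupleSum_pos (hx : ∀ e, 0 < x e) {k : ℕ} {S T : Multiset α}
    (hT : M.MultisetIndep T) (hS : M.MultisetIndep S)
    (h : Multiset.card T + k ≤ Multiset.card S) : 0 < tupleSum M.indepIndicator x k T := by
  induction k generalizing T with
  | zero => simp [tupleSum, Matroid.indepIndicator, hT]
  | succ k ih =>
    obtain ⟨e, -, he⟩ := hT.augment hS (by omega)
    refine Finset.sum_pos' (fun f _ => mul_nonneg (hx f).le
      (tupleSum_nonneg M.indepIndicator_nonneg (fun e => (hx e).le) _ _))
      ⟨e, Finset.mem_univ e, mul_pos (hx e) (ih he ?_)⟩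
    rw [Multiset.card_cons]
    omega

theorem Matroid.exists_multisetIndep_of_tupleSum_ne_zero {k : ℕ} {T : Multiset α}
    (h : tupleSum M.indepIndicator x k T ≠ 0) :
    ∃ S, M.MultisetIndep S ∧ T ≤ S ∧ Multiset.card S = Multiset.card T + k := by
  induction k generalizing T with
  | zero =>
    refine ⟨T, ?_, le_rfl, rfl⟩
    by_contra hT
    exact h (if_neg hT)
  | succ k ih =>
    obtain ⟨e, -, he⟩ := Finset.exists_ne_zero_of_sum_ne_zero h
    obtain ⟨S, hS, hle, hcard⟩ := ih (right_ne_zero_of_mul he)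
    refine ⟨S, hS, (Multiset.le_cons_self T e).trans hle, ?_⟩
    rw [hcard, Multiset.card_cons]
    omega

/-- A form `s² - ∑_P s_P²`, where `s` is the sum of all coordinates in `N` and `s_P` are the sums
over the fibres of `κ`, is Lorentzian. -/
theorem lorentzianAt_complete_multipartite {β : Type*} {A : Matrix α α ℝ} (N : Finset α)
    (κ : α → β) (hA : ∀ e f, A e f = if e ∈ N ∧ f ∈ N ∧ κ e ≠ κ f then 1 else 0)
    (hx : ∀ e, 0 < x e) : LorentzianAt A x := by
  have hsymm : A.IsSymm := by
    ext e f
    rw [transpose_apply, hA, hA]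
    congr 1
    rw [ne_comm, eq_iff_iff]
    tauto
  have hA0 (e f : α) : 0 ≤ A e f := by
    rw [hA]
    split_ifs <;> norm_num
  set s : (α → ℝ) → ℝ := fun v => ∑ e ∈ N, v e with hs
  set p : (α → ℝ) → β → ℝ := fun v b => ∑ e ∈ N with κ e = b, v e with hp
  have hform (v w : α → ℝ) :
      v ⬝ᵥ A *ᵥ w = s v * s w - ∑ b ∈ N.image κ, p v b * p w b := by
    have h1 : v ⬝ᵥ A *ᵥ w =
        ∑ e ∈ N, ∑ f ∈ N, (v e * w f - if κ f = κ e then v e * w f else 0) := by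
      simp only [dotProduct, mulVec, Finset.mul_sum, hA]
      rw [← Finset.sum_subset (Finset.subset_univ N)]
      · refine Finset.sum_congr rfl fun e he => ?_
        rw [← Finset.sum_subset (Finset.subset_univ N)]
        · refine Finset.sum_congr rfl fun f hf => ?_
          by_cases h : κ e = κ f
          · simp [h]
          · simp [he, hf, h, Ne.symm h]
        · intro f _ hf
          simp [hf]
      · intro e _ he
        simp [he]
    have h2 : ∑ b ∈ N.image κ, p v b * p w b =
        ∑ e ∈ N, ∑ f ∈ N, if κ f = κ e then v e * w f else 0 := by
      rw [← Finset.sum_fiberwise_of_maps_to (t := N.image κ) (g := κ)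
        fun e he => Finset.mem_image_of_mem κ he]
      refine Finset.sum_congr rfl fun b _ => ?_
      simp only [hp, Finset.sum_mul]
      refine Finset.sum_congr rfl fun e he => ?_
      rw [(Finset.mem_filter.1 he).2, Finset.mul_sum, Finset.sum_filter]
    rw [h1, h2, hs]
    simp only [Finset.sum_sub_distrib, Finset.sum_mul_sum]
  refine lorentzianAt_of_orthogonal hsymm (dotProduct_mulVec_nonneg hA0 hx) fun hpos v hv => ?_
  rw [hform] at hpos hv ⊢
  have hcs := Finset.sum_mul_sq_le_sq_mul_sq (N.image κ) (p v) (p x)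
  simp only [← sq] at hpos ⊢
  rw [sub_eq_zero] at hv
  rw [← hv] at hcs
  have hq : 0 ≤ ∑ b ∈ N.image κ, p v b ^ 2 := Finset.sum_nonneg fun _ _ => sq_nonneg _
  have hq' : 0 ≤ ∑ b ∈ N.image κ, p x b ^ 2 := Finset.sum_nonneg fun _ _ => sq_nonneg _
  have hsx : 0 < s x ^ 2 := by linarith
  have : s v ^ 2 * s x ^ 2 ≤ (∑ b ∈ N.image κ, p v b ^ 2) * s x ^ 2 := by
    rw [← mul_pow]
    exact hcs.trans (mul_le_mul_of_nonneg_left (by linarith) hq)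
  linarith [le_of_mul_le_mul_right this hsx]

theorem Matroid.lorentzianAt_tupleHess (hE : M.E = Set.univ) (hx : ∀ e, 0 < x e) (k : ℕ)
    (T : Multiset α) : LorentzianAt (tupleHess M.indepIndicator x k T) x := by
  induction k generalizing T with
  | zero =>
    refine lorentzianAt_complete_multipartite {e | M.MultisetIndep (e ::ₘ T)}
      (fun e => M.closure (insert e {a | a ∈ T})) (fun e f => ?_) hx
    simp only [tupleHess_apply, tupleSum, Matroid.indepIndicator, Finset.mem_filter,
      Finset.mem_univ, true_and]
    congr 1
    rw [eq_iff_iff]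
    constructor
    · intro h
      have he : M.MultisetIndep (e ::ₘ T) :=
        h.subset (Multiset.cons_le_cons e (Multiset.le_cons_self T f))
      have hf : M.MultisetIndep (f ::ₘ T) := h.subset (Multiset.le_cons_self _ e)
      exact ⟨he, hf, (Matroid.multisetIndep_cons_cons_iff hE he hf).1 h⟩
    · rintro ⟨he, hf, h⟩
      exact (Matroid.multisetIndep_cons_cons_iff hE he hf).2 h
  | succ k ih =>
    refine lorentzianAt_tupleHess_succ M.indepIndicator_nonneg hx k T (fun e => ih _) ?_
    intro w hw e f he hf
    obtain ⟨S, hS, heS, hcard⟩ := Matroid.exists_multisetIndep_of_tupleSum_ne_zero he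
    obtain ⟨S', hS', hfS', -⟩ := Matroid.exists_multisetIndep_of_tupleSum_ne_zero hf
    have he' := hS.subset heS
    have hf' := hS'.subset hfS'
    rw [Multiset.card_cons] at hcard
    have hadj {a b : α} (h : M.MultisetIndep (a ::ₘ b ::ₘ T)) : w a = w b := by
      refine hw a b (Matroid.tupleSum_pos hx h hS ?_).ne'
      rw [Multiset.card_cons, Multiset.card_cons]
      omega
    by_cases hef : M.MultisetIndep (e ::ₘ f ::ₘ T)
    · exact hadj hef
    · obtain ⟨g, -, hg⟩ := he'.augment hS (by rw [Multiset.card_cons]; omega)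
      have hgT : M.MultisetIndep (g ::ₘ T) :=
        hg.subset (Multiset.cons_le_cons g (Multiset.le_cons_self T e))
      have hgf : M.MultisetIndep (g ::ₘ f ::ₘ T) := by
        rw [Matroid.multisetIndep_cons_cons_iff hE hgT hf']
        rw [Matroid.multisetIndep_cons_cons_iff hE he' hf', not_not] at hef
        rw [← hef]
        exact (Matroid.multisetIndep_cons_cons_iff hE hgT he').1 hg
      exact (hadj hg).symm.trans (hadj hgf)

theorem Matroid.tupleSum_indepIndicator_zero (k : ℕ) :
    tupleSum M.indepIndicator x k 0 = k.factorial * indepGenPoly M k x := by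
  rw [tupleSum_eq_factorial_mul (c := M.indepIndicator) fun T hT => if_neg fun h => hT h.1, indepGenPoly]
  congr 1
  refine Finset.sum_congr rfl fun S _ => ?_
  have : M.MultisetIndep (S.val + 0) ↔ M.Indep (S : Set α) := by
    rw [add_zero]
    exact and_iff_right S.nodup
  simp only [Matroid.indepIndicator, this, ite_mul, one_mul, zero_mul]

end Independence

section Concavity

open Filter Topology

theorem concaveOn_rpow_of_mul_le_sq {φ φ' φ'' : ℝ → ℝ} {D : Set ℝ} (hD : Convex ℝ D) {p : ℝ}
    (hp : 0 ≤ p) (hφ : ∀ t ∈ D, 0 < φ t) (h1 : ∀ t, HasDerivAt φ (φ' t) t)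
    (h2 : ∀ t, HasDerivAt φ' (φ'' t) t)
    (hle : ∀ t ∈ D, φ t * φ'' t ≤ (1 - p) * φ' t ^ 2) : ConcaveOn ℝ D fun t => φ t ^ p := by
  refine concaveOn_of_hasDerivWithinAt2_nonpos hD (f' := fun t => φ' t * p * φ t ^ (p - 1))
    (f'' := fun t => φ'' t * p * φ t ^ (p - 1) +
      φ' t * p * (φ' t * (p - 1) * φ t ^ (p - 1 - 1))) ?_ ?_ ?_ ?_
  · intro t ht
    exact ((h1 t).continuousAt.rpow_const (Or.inl (hφ t ht).ne')).continuousWithinAt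
  · intro t ht
    exact ((h1 t).rpow_const (Or.inl (hφ t (interior_subset ht)).ne')).hasDerivWithinAt
  · intro t ht
    exact (((h2 t).mul_const p).mul
      ((h1 t).rpow_const (Or.inl (hφ t (interior_subset ht)).ne'))).hasDerivWithinAt
  · intro t ht
    have ht' := interior_subset ht
    have hpos := hφ t ht'
    have hsplit : φ t ^ (p - 1) = φ t ^ (p - 1 - 1) * φ t := by
      rw [← Real.rpow_add_one hpos.ne', sub_add_cancel]
    have hnn : 0 ≤ p * φ t ^ (p - 1 - 1) := mul_nonneg hp (Real.rpow_nonneg hpos.le _)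
    have := mul_nonneg hnn (sub_nonneg.2 (hle t ht'))
    rw [hsplit]
    linarith [this, show p * φ t ^ (p - 1 - 1) * ((1 - p) * φ' t ^ 2 - φ t * φ'' t) =
      -(φ'' t * p * (φ t ^ (p - 1 - 1) * φ t) +
        φ' t * p * (φ' t * (p - 1) * φ t ^ (p - 1 - 1))) by ring]

/-- A continuous function that is concave on the open positive orthant is concave on the closed
nonnegative orthant. -/
theorem concaveOn_nonneg_orthant_of_pos {α : Type*} {g : (α → ℝ) → ℝ} (hg : Continuous g)
    (h : ConcaveOn ℝ {x : α → ℝ | ∀ e, 0 < x e} g) : ConcaveOn ℝ {x : α → ℝ | ∀ e, 0 ≤ x e} g := by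
  refine ⟨fun x hx y hy a b ha hb _ e => add_nonneg (mul_nonneg ha (hx e))
    (mul_nonneg hb (hy e)), fun x hx y hy a b ha hb hab => ?_⟩
  have hlim (z : α → ℝ) : Tendsto (fun ε : ℝ => g (z + fun _ => ε)) (𝓝[>] 0) (𝓝 (g z)) := by
    have hc : Continuous fun ε : ℝ => g (z + fun _ => ε) := by fun_prop
    have h0 : (z + fun _ => (0 : ℝ)) = z := add_zero z
    simpa only [h0] using (hc.tendsto 0).mono_left nhdsWithin_le_nhds
  refine le_of_tendsto_of_tendsto (((hlim x).const_smul a).add ((hlim y).const_smul b))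
    (hlim (a • x + b • y)) ?_
  filter_upwards [self_mem_nhdsWithin] with ε hε
  have hpos {z : α → ℝ} (hz : ∀ e, 0 ≤ z e) : ∀ e, 0 < (z + fun _ => ε : α → ℝ) e :=
    fun e => add_pos_of_nonneg_of_pos (hz e) hε
  refine (h.2 (hpos hx) (hpos hy) ha hb hab).trans_eq (congrArg g ?_)
  ext e
  simp only [Pi.add_apply, Pi.smul_apply, smul_eq_mul]
  linear_combination ε * hab

theorem concaveOn_of_forall_line {E : Type*} [AddCommGroup E] [Module ℝ E] {s : Set E}
    (hs : Convex ℝ s) {g : E → ℝ}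
    (h : ∀ x ∈ s, ∀ y ∈ s, ConcaveOn ℝ (Set.Icc 0 1) fun t : ℝ => g (x + t • (y - x))) :
    ConcaveOn ℝ s g := by
  refine ⟨hs, fun x hx y hy a b ha hb hab => ?_⟩
  have := (h x hx y hy).2 (Set.left_mem_Icc.2 zero_le_one) (Set.right_mem_Icc.2 zero_le_one)
    ha hb hab
  simp only [zero_smul, add_zero, one_smul, add_sub_cancel, smul_eq_mul, mul_zero, mul_one,
    zero_add] at this
  obtain rfl : a = 1 - b := eq_sub_of_add_eq hab
  have hz : (1 - b) • x + b • y = x + b • (y - x) := by module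
  rwa [hz, smul_eq_mul, smul_eq_mul]

variable {α : Type*} [Fintype α]

theorem continuous_tupleSum (c : Multiset α → ℝ) (k : ℕ) (T : Multiset α) :
    Continuous fun x => tupleSum c x k T := by
  induction k generalizing T with
  | zero => exact continuous_const
  | succ k ih => exact continuous_finsetSum _ fun e _ => (continuous_apply e).mul (ih _)

theorem tupleSum_rpow_concaveOn_pos {c : Multiset α → ℝ} {k : ℕ}
    (hpos : ∀ x : α → ℝ, (∀ e, 0 < x e) → 0 < tupleSum c x (k + 2) 0)
    (hlor : ∀ x : α → ℝ, (∀ e, 0 < x e) → LorentzianAt (tupleHess c x k 0) x) :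
    ConcaveOn ℝ {x : α → ℝ | ∀ e, 0 < x e}
      fun x => tupleSum c x (k + 2) 0 ^ ((1 : ℝ) / (k + 2 : ℕ)) := by
  have hconv : Convex ℝ {x : α → ℝ | ∀ e, 0 < x e} := by
    rw [Set.ofPred_forall]
    exact convex_iInter fun e => convex_halfSpace_gt (LinearMap.proj e).isLinear 0
  refine concaveOn_of_forall_line hconv fun x hx y hy => ?_
  set v := y - x
  have hline (t : ℝ) (ht : t ∈ Set.Icc (0 : ℝ) 1) : ∀ e, 0 < (x + t • v) e :=
    hconv.add_smul_sub_mem hx hy ht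
  refine concaveOn_rpow_of_mul_le_sq (φ := fun t => tupleSum c (x + t • v) (k + 2) 0)
    (φ' := fun t => (k + 2) * ∑ e, v e * tupleSum c (x + t • v) (k + 1) (e ::ₘ 0))
    (φ'' := fun t => (k + 2) * ((k + 1) * (v ⬝ᵥ tupleHess c (x + t • v) k 0 *ᵥ v)))
    (convex_Icc 0 1) (by positivity) (fun t ht => hpos _ (hline t ht)) (fun t => ?_)
    (fun t => ?_) (fun t ht => ?_)
  · refine (hasDerivAt_tupleSum c x v (k + 1) 0 t).congr_deriv ?_
    push_cast
    ring
  · refine ((HasDerivAt.fun_sum (u := Finset.univ) fun e _ =>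
      (hasDerivAt_tupleSum c x v k (e ::ₘ 0) t).const_mul (v e)).const_mul
        ((k : ℝ) + 2)).congr_deriv ?_
    congr 1
    simp only [dotProduct, mulVec, tupleHess_apply, Finset.mul_sum]
    refine Finset.sum_congr rfl fun e _ => Finset.sum_congr rfl fun f _ => ?_
    rw [Multiset.cons_swap]
    ring
  · have h := hlor _ (hline t ht) v
    rw [dotProduct_tupleHess_mulVec_self, dotProduct_tupleHess_mulVec_self] at h
    change _ * tupleSum c (x + t • v) (k + 2) 0 ≤ _ at h
    set q := v ⬝ᵥ tupleHess c (x + t • v) k 0 *ᵥ v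
    set φ := tupleSum c (x + t • v) (k + 2) 0
    set b := ∑ e, v e * tupleSum c (x + t • v) (k + 1) (e ::ₘ 0)
    have hk : (0 : ℝ) ≤ (k + 2) * (k + 1) := by positivity
    have h1 : (1 - (1 : ℝ) / (k + 2 : ℕ)) * ((k + 2) * b) ^ 2 = (k + 2) * (k + 1) * b ^ 2 := by
      push_cast
      field_simp
      ring
    rw [h1]
    linarith [mul_le_mul_of_nonneg_left h hk]

end Concavity

/-- **Matroid polynomial concavity.** If `1 ≤ K ≤ rank M` (i.e. there is an independent
set of size `K`), then `h_{M,K}(x) = f_{M,K}(x)^{1/K}` is concave on the nonnegative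
orthant. -/
theorem matroid_indepGenPoly_rpow_concave {α : Type*} [Fintype α] (M : Matroid α)
    (hE : M.E = Set.univ) (K : ℕ) (hK : 1 ≤ K)
    (hrank : ∃ I : Finset α, M.Indep (I : Set α) ∧ I.card = K) :
    ConcaveOn ℝ {x : α → ℝ | ∀ e, 0 ≤ x e}
      (fun x => (indepGenPoly M K x) ^ ((1 : ℝ) / K)) := by
  obtain ⟨I, hI, hIK⟩ := hrank
  have hI' : M.MultisetIndep I.val := ⟨I.nodup, hI⟩
  have hfac : (0 : ℝ) < K.factorial := by exact_mod_cast K.factorial_pos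
  have hgen (x : α → ℝ) : indepGenPoly M K x =
      (K.factorial : ℝ)⁻¹ * tupleSum M.indepIndicator x K 0 := by
    rw [Matroid.tupleSum_indepIndicator_zero, inv_mul_cancel_left₀ hfac.ne']
  have hcont : Continuous fun x => tupleSum M.indepIndicator x K 0 ^ ((1 : ℝ) / K) :=
    (continuous_tupleSum _ K 0).rpow_const fun _ => Or.inr (by positivity)
  have hpos : ConcaveOn ℝ {x : α → ℝ | ∀ e, 0 ≤ x e}
      fun x => tupleSum M.indepIndicator x K 0 ^ ((1 : ℝ) / K) := by
    obtain _ | _ | k := K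
    · omega
    · have hlin : (fun x : α → ℝ => tupleSum M.indepIndicator x (0 + 1) 0 ^
          ((1 : ℝ) / (0 + 1 : ℕ))) = fun x => (fun e => M.indepIndicator (e ::ₘ 0)) ⬝ᵥ x := by
        ext x
        simp [tupleSum, dotProduct, mul_comm]
      rw [hlin]
      refine ⟨fun x hx y hy a b ha hb _ e => add_nonneg (mul_nonneg ha (hx e))
        (mul_nonneg hb (hy e)), fun x _ y _ a b _ _ _ => ?_⟩
      simp only [dotProduct_add, dotProduct_smul, le_refl]
    · refine concaveOn_nonneg_orthant_of_pos hcont (tupleSum_rpow_concaveOn_pos ?_ ?_)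
      · refine fun x hx => Matroid.tupleSum_pos hx (hI'.subset (Multiset.zero_le _)) hI' ?_
        rw [Multiset.card_zero, zero_add, Finset.card_val, hIK]
      · exact fun x hx => Matroid.lorentzianAt_tupleHess hE hx k 0
  refine (hpos.smul (c := (K.factorial : ℝ)⁻¹ ^ ((1 : ℝ) / K)) (by positivity)).congr
    fun x hx => ?_
  simp only [hgen, smul_eq_mul]
  rw [Real.mul_rpow (by positivity) (tupleSum_nonneg M.indepIndicator_nonneg hx _ _)]
end

section
/- Let M be a matroid on a finite ground set E and let K be an integer with 1 ≤ K ≤ rank(M). Then the degree-K independent-set generating polynomial f_{M,K} is quasi-concave on the nonnegative orthant: for every a ≥ 0, the superlevel set {x ∈ ℝ_{≥0}^E : f_{M,K}(x) ≥ a} is a convex subset of ℝ^E. -/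
open Finset Classical

/-- A real symmetric matrix is nonpositive on every vector orthogonal to all its eigenvectors with
positive eigenvalue. -/
theorem dotProduct_mulVec_nonpos_of_orthogonal {ι : Type*} [Fintype ι] {A : Matrix ι ι ℝ}
    (hA : A.IsHermitian) (y : ι → ℝ)
    (h : ∀ (c : ℝ) (z : ι → ℝ), 0 < c → A.mulVec z = c • z → z ⬝ᵥ y = 0) :
    y ⬝ᵥ A.mulVec y ≤ 0 := by
  set b := hA.eigenvectorBasis
  have hin : ∀ p q : ι → ℝ, inner ℝ (WithLp.toLp 2 p) (WithLp.toLp 2 q) = p ⬝ᵥ q := by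
    intro p q
    simp [EuclideanSpace.inner_eq_star_dotProduct, dotProduct_comm]
  have hbk : ∀ k (q : ι → ℝ), inner ℝ (b k) (WithLp.toLp 2 q) = (b k).ofLp ⬝ᵥ q := by
    intro k q
    exact hin (b k).ofLp q
  have hsum := b.sum_inner_mul_inner (WithLp.toLp 2 y) (WithLp.toLp 2 (A.mulVec y))
  rw [hin] at hsum
  rw [← hsum]
  refine Finset.sum_nonpos fun k _ => ?_
  rw [real_inner_comm, hbk, hbk, Matrix.dotProduct_mulVec, ← Matrix.mulVec_transpose]
  have hT : A.transpose = A := by simpa using hA.eq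
  rw [hT, hA.mulVec_eigenvectorBasis, smul_dotProduct, smul_eq_mul]
  rcases le_or_gt (hA.eigenvalues k) 0 with hk | hk
  · nlinarith [mul_self_nonneg ((b k).ofLp ⬝ᵥ y)]
  · have := h _ _ hk (hA.mulVec_eigenvectorBasis k)
    simp [b, this]

/-- A nonnegative symmetric matrix with connected support which satisfies a Bochner-type
inequality is nonpositive on the vectors of weighted mean zero. -/
theorem sum_mul_nonpos_of_bochner {ι : Type*} [Fintype ι] {W : ι → ι → ℝ}
    (hsymm : ∀ i j, W i j = W j i) (hnonneg : ∀ i j, 0 ≤ W i j)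
    (hconn : ∀ i j, 0 < ∑ k, W i k → 0 < ∑ k, W j k →
      0 < W i j ∨ ∃ k, 0 < W i k ∧ 0 < W k j)
    (hbochner : ∀ u : ι → ℝ, ∑ i, ∑ j, W i j * u i * u j ≤
      ∑ i, (∑ j, W i j * u j) ^ 2 / ∑ j, W i j)
    (v : ι → ℝ) (hv : ∑ i, (∑ j, W i j) * v i = 0) :
    ∑ i, ∑ j, W i j * v i * v j ≤ 0 := by
  set w : ι → ℝ := fun i => ∑ j, W i j with hw
  have hw0 : ∀ i, 0 ≤ w i := fun i => Finset.sum_nonneg fun j _ => hnonneg i j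
  have hWw : ∀ i j, w i = 0 → W i j = 0 := fun i j hi =>
    (Finset.sum_eq_zero_iff_of_nonneg fun j _ => hnonneg i j).1 hi j (Finset.mem_univ j)
  have hWw' : ∀ i j, w j = 0 → W i j = 0 := fun i j hj => hsymm i j ▸ hWw j i hj
  set r : ι → ℝ := fun i => √(w i) with hr
  have hr2 : ∀ i, r i ^ 2 = w i := fun i => Real.sq_sqrt (hw0 i)
  have hr0 : ∀ i, r i = 0 → w i = 0 := fun i hi => by rw [← hr2, hi]; norm_num
  let A : Matrix ι ι ℝ := Matrix.of fun i j => W i j / (r i * r j)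
  have hAmul : ∀ (z : ι → ℝ) i, A.mulVec z i = (∑ j, W i j * (z j / r j)) / r i := by
    intro z i
    simp only [Matrix.mulVec, dotProduct, A, Matrix.of_apply, Finset.sum_div]
    refine Finset.sum_congr rfl fun j _ => ?_
    rw [div_mul_eq_mul_div, mul_div_assoc', div_div, mul_comm (r j)]
  have hAquad : ∀ z : ι → ℝ, z ⬝ᵥ A.mulVec z = ∑ i, ∑ j, W i j * (z i / r i) * (z j / r j) := by
    intro z
    refine Finset.sum_congr rfl fun i _ => ?_
    rw [hAmul, mul_div_assoc', Finset.mul_sum, Finset.sum_div]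
    refine Finset.sum_congr rfl fun j _ => ?_
    ring
  have hA : A.IsHermitian := by
    ext i j
    simp [A, hsymm i j, mul_comm (r i)]
  have hvr : ∀ i, w i ≠ 0 → r i * v i / r i = v i := fun i hi =>
    mul_div_cancel_left₀ _ fun h => hi (hr0 i h)
  have key := dotProduct_mulVec_nonpos_of_orthogonal hA (fun i => r i * v i) ?_
  · rw [hAquad] at key
    refine le_of_eq_of_le (Finset.sum_congr rfl fun i _ => Finset.sum_congr rfl fun j _ => ?_) key
    by_cases hi : w i = 0
    · simp [hWw i j hi]
    by_cases hj : w j = 0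
    · simp [hWw' i j hj]
    rw [hvr i hi, hvr j hj]
  intro c z hc hz
  set u : ι → ℝ := fun i => z i / r i with hu
  have hzi : ∀ i, (∑ j, W i j * u j) / r i = c * z i := by
    intro i
    rw [← hAmul, hz, Pi.smul_apply, smul_eq_mul]
  have hz0 : ∀ i, w i = 0 → z i = 0 := by
    intro i hi
    have := hzi i
    rw [show r i = 0 by simp [hr, hi], div_zero] at this
    exact (mul_eq_zero.1 this.symm).resolve_left hc.ne'
  have hzu : ∀ i, z i = r i * u i := by
    intro i
    by_cases hi : r i = 0
    · simp [hz0 i (hr0 i hi), hi]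
    · rw [hu]; field_simp
  have hz2 : ∀ i, z i ^ 2 = w i * u i ^ 2 := fun i => by rw [hzu, mul_pow, hr2]
  have hquad : ∑ i, ∑ j, W i j * u i * u j = c * ∑ i, z i ^ 2 := by
    rw [← hAquad, hz, dotProduct_smul, smul_eq_mul]
    simp [dotProduct, pow_two]
  have hsq : ∑ i, (∑ j, W i j * u j) ^ 2 / ∑ j, W i j = c ^ 2 * ∑ i, z i ^ 2 := by
    rw [Finset.mul_sum]
    refine Finset.sum_congr rfl fun i _ => ?_
    rw [← mul_pow, ← hzi i, div_pow, hr2]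
  have hN : 0 ≤ ∑ i, z i ^ 2 := Finset.sum_nonneg fun i _ => sq_nonneg _
  have hdir : ∑ i, ∑ j, W i j * (u i - u j) ^ 2 = 2 * (1 - c) * ∑ i, z i ^ 2 := by
    have h1 : ∑ i, ∑ j, W i j * u i ^ 2 = ∑ i, z i ^ 2 :=
      Finset.sum_congr rfl fun i _ => by rw [hz2, ← Finset.sum_mul]
    have h2 : ∑ i, ∑ j, W i j * u j ^ 2 = ∑ i, z i ^ 2 := by
      rw [Finset.sum_comm, ← h1]
      exact Finset.sum_congr rfl fun i _ => Finset.sum_congr rfl fun j _ => by rw [hsymm]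
    have h3 : ∑ i, ∑ j, W i j * (u i - u j) ^ 2 = ∑ i, ∑ j, W i j * u i ^ 2 +
        ∑ i, ∑ j, W i j * u j ^ 2 - 2 * ∑ i, ∑ j, W i j * u i * u j := by
      simp only [Finset.mul_sum, ← Finset.sum_add_distrib, ← Finset.sum_sub_distrib]
      exact Finset.sum_congr rfl fun i _ => Finset.sum_congr rfl fun j _ => by ring
    rw [h3, h1, h2, hquad]
    ring
  have hdir0 : ∑ i, ∑ j, W i j * (u i - u j) ^ 2 = 0 := by
    refine le_antisymm ?_ (Finset.sum_nonneg fun i _ => Finset.sum_nonneg fun j _ =>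
      mul_nonneg (hnonneg i j) (sq_nonneg _))
    have hb := hbochner u
    rw [hquad, hsq] at hb
    rw [hdir]
    rcases hN.eq_or_lt with h | h
    · rw [← h]; simp
    · have : c * 1 ≤ c * c := by
        refine le_of_mul_le_mul_right ?_ h
        linarith
      have := le_of_mul_le_mul_left this hc
      nlinarith
  have huij : ∀ i j, 0 < W i j → u i = u j := by
    intro i j hij
    have h1 := (Finset.sum_eq_zero_iff_of_nonneg fun i _ => Finset.sum_nonneg fun j _ =>
      mul_nonneg (hnonneg i j) (sq_nonneg _)).1 hdir0 i (Finset.mem_univ i)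
    have h2 := (Finset.sum_eq_zero_iff_of_nonneg fun j _ =>
      mul_nonneg (hnonneg i j) (sq_nonneg _)).1 h1 j (Finset.mem_univ j)
    have h3 := (mul_eq_zero.1 h2).resolve_left hij.ne'
    exact sub_eq_zero.1 (pow_eq_zero_iff two_ne_zero |>.1 h3)
  have hconst : ∀ i j, 0 < w i → 0 < w j → u i = u j := by
    intro i j hi hj
    rcases hconn i j hi hj with h | ⟨k, hik, hkj⟩
    · exact huij i j h
    · exact (huij i k hik).trans (huij k j hkj)
  have hdot : z ⬝ᵥ (fun i => r i * v i) = ∑ i, w i * v i * u i :=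
    Finset.sum_congr rfl fun i _ => by rw [hzu, ← hr2]; ring
  rw [hdot]
  by_cases hex : ∃ i, 0 < w i
  · obtain ⟨i₀, hi₀⟩ := hex
    have : ∑ i, w i * v i * u i = (∑ i, w i * v i) * u i₀ := by
      rw [Finset.sum_mul]
      refine Finset.sum_congr rfl fun i _ => ?_
      rcases (hw0 i).eq_or_lt with h | h
      · simp [← h]
      · rw [hconst i i₀ h hi₀]
    rw [this, hv, zero_mul]
  · push Not at hex
    exact Finset.sum_eq_zero fun i _ => by rw [le_antisymm (hex i) (hw0 i)]; simp

/-- Reverse Cauchy–Schwarz inequality from nonpositivity at a single translate. -/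
theorem sum_mul_mul_sum_le_sq {ι : Type*} [Fintype ι] {W : ι → ι → ℝ}
    (hsymm : ∀ i j, W i j = W j i) (hnonneg : ∀ i j, 0 ≤ W i j) (v : ι → ℝ) (t : ℝ)
    (h : ∑ i, ∑ j, W i j * (v i - t) * (v j - t) ≤ 0) :
    (∑ i, ∑ j, W i j * v i * v j) * (∑ i, ∑ j, W i j) ≤ (∑ i, ∑ j, W i j * v j) ^ 2 := by
  have hQ : 0 ≤ ∑ i, ∑ j, W i j :=
    Finset.sum_nonneg fun i _ => Finset.sum_nonneg fun j _ => hnonneg i j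
  have hswap : ∑ i, ∑ j, W i j * v i = ∑ i, ∑ j, W i j * v j := by
    rw [Finset.sum_comm]
    exact Finset.sum_congr rfl fun i _ => Finset.sum_congr rfl fun j _ => by rw [hsymm]
  have hexp : ∑ i, ∑ j, W i j * (v i - t) * (v j - t) = ∑ i, ∑ j, W i j * v i * v j -
      t * ∑ i, ∑ j, W i j * v i - t * ∑ i, ∑ j, W i j * v j + t ^ 2 * ∑ i, ∑ j, W i j := by
    simp only [Finset.mul_sum, ← Finset.sum_add_distrib, ← Finset.sum_sub_distrib]
    exact Finset.sum_congr rfl fun i _ => Finset.sum_congr rfl fun j _ => by ring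
  rw [hexp, hswap] at h
  nlinarith [mul_nonneg hQ (neg_nonneg.2 h),
    sq_nonneg (∑ i, ∑ j, W i j * v j - t * ∑ i, ∑ j, W i j)]

/-- Local-to-global principle for the reverse Cauchy–Schwarz inequality. -/
theorem sum_mul_mul_sum_le_sq_of_local {ι : Type*} [Fintype ι] {W : ι → ι → ℝ}
    {T : ι → ι → ι → ℝ} {c : ℝ} (hc : 0 < c)
    (hsymm : ∀ i j, W i j = W j i) (hnonneg : ∀ i j, 0 ≤ W i j)
    (hconn : ∀ i j, 0 < ∑ k, W i k → 0 < ∑ k, W j k →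
      0 < W i j ∨ ∃ k, 0 < W i k ∧ 0 < W k j)
    (hTnonneg : ∀ k i j, 0 ≤ T k i j)
    (hTsum : ∀ i j, ∑ k, T k i j = c * W i j) (hTrow : ∀ k j, ∑ i, T k i j = c * W k j)
    (hT : ∀ k (v : ι → ℝ), (∑ i, ∑ j, T k i j * v i * v j) * (∑ i, ∑ j, T k i j) ≤
      (∑ i, ∑ j, T k i j * v j) ^ 2)
    (v : ι → ℝ) :
    (∑ i, ∑ j, W i j * v i * v j) * (∑ i, ∑ j, W i j) ≤ (∑ i, ∑ j, W i j * v j) ^ 2 := by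
  have hTtot : ∀ k, ∑ i, ∑ j, T k i j = c * ∑ j, W k j := by
    intro k
    rw [Finset.sum_comm, Finset.mul_sum]
    exact Finset.sum_congr rfl fun j _ => hTrow k j
  have hTlin : ∀ k (u : ι → ℝ), ∑ i, ∑ j, T k i j * u j = c * ∑ j, W k j * u j := by
    intro k u
    rw [Finset.sum_comm, Finset.mul_sum]
    refine Finset.sum_congr rfl fun j _ => ?_
    rw [← Finset.sum_mul, hTrow, mul_assoc]
  have hlocal : ∀ k (u : ι → ℝ), ∑ i, ∑ j, T k i j * u i * u j ≤
      c * ((∑ j, W k j * u j) ^ 2 / ∑ j, W k j) := by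
    intro k u
    have hk := hT k u
    rw [hTtot, hTlin] at hk
    rcases (Finset.sum_nonneg fun j (_ : j ∈ Finset.univ) => hnonneg k j).eq_or_lt with h | h
    · have hzero : ∀ i j, T k i j = 0 := by
        have htot := hTtot k
        rw [← h, mul_zero] at htot
        intro i j
        have h1 := (Finset.sum_eq_zero_iff_of_nonneg fun i _ => Finset.sum_nonneg fun j _ =>
          hTnonneg k i j).1 htot i (Finset.mem_univ i)
        exact (Finset.sum_eq_zero_iff_of_nonneg fun j _ => hTnonneg k i j).1 h1 j
          (Finset.mem_univ j)
      simp [hzero, ← h]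
    · rw [mul_div_assoc', le_div_iff₀ h]
      refine le_of_mul_le_mul_left ?_ hc
      linarith
  have hbochner : ∀ u : ι → ℝ, ∑ i, ∑ j, W i j * u i * u j ≤
      ∑ i, (∑ j, W i j * u j) ^ 2 / ∑ j, W i j := by
    intro u
    refine le_of_mul_le_mul_left ?_ hc
    calc c * ∑ i, ∑ j, W i j * u i * u j = ∑ i, ∑ j, ∑ k, T k i j * u i * u j := by
          simp only [Finset.mul_sum, ← Finset.sum_mul, hTsum, mul_assoc]
      _ = ∑ k, ∑ i, ∑ j, T k i j * u i * u j := by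
          rw [Finset.sum_comm (s := Finset.univ) (t := Finset.univ)
            (f := fun k i => ∑ j, T k i j * u i * u j)]
          exact Finset.sum_congr rfl fun i _ => Finset.sum_comm
      _ ≤ ∑ k, c * ((∑ j, W k j * u j) ^ 2 / ∑ j, W k j) :=
          Finset.sum_le_sum fun k _ => hlocal k u
      _ = _ := (Finset.mul_sum _ _ _).symm
  set m := (∑ i, (∑ j, W i j) * v i) / ∑ i, ∑ j, W i j with hm
  refine sum_mul_mul_sum_le_sq hsymm hnonneg v m
    (sum_mul_nonpos_of_bochner hsymm hnonneg hconn hbochner _ ?_)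
  simp only [mul_sub, Finset.sum_sub_distrib, ← Finset.sum_mul]
  by_cases h : ∑ i, ∑ j, W i j = 0
  · have h0 : ∀ i, ∑ j, W i j = 0 := fun i =>
      (Finset.sum_eq_zero_iff_of_nonneg fun i _ => Finset.sum_nonneg fun j _ =>
        hnonneg i j).1 h i (Finset.mem_univ i)
    simp [h0]
  · rw [hm, mul_div_cancel₀ _ h, sub_self]

/-- A family of finite sets satisfying the hereditary and augmentation axioms of matroid
independence. The empty family is allowed. -/
structure IsIndepFamily {α : Type*} (P : Finset α → Prop) : Prop where
  subset : ∀ {S T : Finset α}, P T → S ⊆ T → P S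
  augment : ∀ {S T : Finset α}, P S → P T → S.card < T.card → ∃ e ∈ T, e ∉ S ∧ P (insert e S)

/-- The link of a family of finite sets at an element. -/
def familyLink {α : Type*} (P : Finset α → Prop) (i : α) (S : Finset α) : Prop :=
  i ∉ S ∧ P (insert i S)

/-- The degree-`d` generating polynomial of a family of finite sets. -/
noncomputable def familyGenPoly {α : Type*} [Fintype α] (P : Finset α → Prop) (d : ℕ)
    (x : α → ℝ) : ℝ :=
  ∑ S ∈ Finset.univ.powersetCard d, if P S then ∏ e ∈ S, x e else 0

theorem Matroid.isIndepFamily {α : Type*} (M : Matroid α) :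
    IsIndepFamily fun S : Finset α => M.Indep (S : Set α) where
  subset hT hST := hT.subset (Finset.coe_subset.2 hST)
  augment hS hT hlt := by simpa using hS.augment_finset hT hlt

theorem familyLink_comm {α : Type*} (P : Finset α → Prop) (i j : α) :
    familyLink (familyLink P i) j = familyLink (familyLink P j) i := by
  funext S
  simp only [familyLink, Finset.mem_insert, not_or, Finset.insert_comm i j, eq_comm (a := i)]
  exact propext (by tauto)

theorem IsIndepFamily.link {α : Type*} {P : Finset α → Prop} (hP : IsIndepFamily P) (i : α) :
    IsIndepFamily (familyLink P i) where
  subset hT hST := ⟨fun h => hT.1 (hST h), hP.subset hT.2 (Finset.insert_subset_insert i hST)⟩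
  augment := by
    rintro S T ⟨hiS, hS⟩ ⟨hiT, hT⟩ hlt
    obtain ⟨e, heT, heS, he⟩ := hP.augment hS hT
      (by rwa [Finset.card_insert_of_notMem hiS, Finset.card_insert_of_notMem hiT,
        Nat.add_lt_add_iff_right])
    rw [Finset.mem_insert, not_or] at heS
    refine ⟨e, Finset.mem_of_mem_insert_of_ne heT heS.1, heS.2, ?_, ?_⟩
    · simpa [hiS] using Ne.symm heS.1
    · rwa [Finset.insert_comm]

theorem IsIndepFamily.exists_superset_card_eq {α : Type*} {P : Finset α → Prop}
    (hP : IsIndepFamily P) {S T : Finset α} (hS : P S) (hT : P T) (h : S.card ≤ T.card) :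
    ∃ U, S ⊆ U ∧ P U ∧ U.card = T.card := by
  induction hn : T.card - S.card generalizing S with
  | zero => exact ⟨S, subset_rfl, hS, by omega⟩
  | succ n ih =>
    obtain ⟨e, -, heS, he⟩ := hP.augment hS hT (by omega)
    have hc := Finset.card_insert_of_notMem heS
    obtain ⟨U, hU, hPU, hcU⟩ := ih he (by omega) (by omega)
    exact ⟨U, (Finset.subset_insert e S).trans hU, hPU, hcU⟩

theorem familyGenPoly_nonneg {α : Type*} [Fintype α] (P : Finset α → Prop) (d : ℕ) {x : α → ℝ}
    (hx : ∀ e, 0 ≤ x e) : 0 ≤ familyGenPoly P d x :=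
  Finset.sum_nonneg fun S _ => by
    split_ifs
    exacts [Finset.prod_nonneg fun e _ => hx e, le_rfl]

theorem familyGenPoly_mono {α : Type*} [Fintype α] (P : Finset α → Prop) (d : ℕ) {x y : α → ℝ}
    (hx : ∀ e, 0 ≤ x e) (hxy : ∀ e, x e ≤ y e) : familyGenPoly P d x ≤ familyGenPoly P d y :=
  Finset.sum_le_sum fun S _ => by
    split_ifs
    exacts [Finset.prod_le_prod (fun e _ => hx e) fun e _ => hxy e, le_rfl]

theorem familyGenPoly_pos_iff {α : Type*} [Fintype α] (P : Finset α → Prop) (d : ℕ) {x : α → ℝ}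
    (hx : ∀ e, 0 < x e) : 0 < familyGenPoly P d x ↔ ∃ S, S.card = d ∧ P S := by
  have hterm : ∀ S ∈ (Finset.univ : Finset α).powersetCard d,
      0 ≤ if P S then ∏ e ∈ S, x e else 0 := fun S _ => by
    split_ifs
    exacts [Finset.prod_nonneg fun e _ => (hx e).le, le_rfl]
  rw [familyGenPoly, Finset.sum_pos_iff_of_nonneg hterm]
  constructor
  · rintro ⟨S, hS, h⟩
    refine ⟨S, (Finset.mem_powersetCard.1 hS).2, ?_⟩
    by_contra hPS
    simp [hPS] at h
  · rintro ⟨S, hS, hPS⟩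
    refine ⟨S, Finset.mem_powersetCard.2 ⟨Finset.subset_univ S, hS⟩, ?_⟩
    rw [if_pos hPS]
    exact Finset.prod_pos fun e _ => hx e

/-- Removing a marked element from a finite set of size `d + 1`, as a reindexing of sums. -/
theorem sum_powersetCard_succ_sum_erase {α : Type*} [Fintype α] (d : ℕ)
    (G : α → Finset α → ℝ) :
    ∑ S ∈ (Finset.univ : Finset α).powersetCard (d + 1), ∑ e ∈ S, G e (S.erase e) =
      ∑ e, ∑ T ∈ (Finset.univ : Finset α).powersetCard d, if e ∉ T then G e T else 0 := by
  simp_rw [← Finset.sum_filter]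
  rw [Finset.sum_sigma', Finset.sum_sigma']
  refine Finset.sum_bij' (fun p _ => ⟨p.2, p.1.erase p.2⟩) (fun p _ => ⟨insert p.1 p.2, p.1⟩)
    ?_ ?_ ?_ ?_ ?_
  · rintro ⟨S, e⟩ h
    simp only [Finset.mem_sigma, Finset.mem_powersetCard, Finset.mem_filter] at h ⊢
    simp [Finset.card_erase_of_mem h.2, h.1.2]
  · rintro ⟨e, T⟩ h
    simp only [Finset.mem_sigma, Finset.mem_powersetCard, Finset.mem_filter] at h ⊢
    simp [Finset.card_insert_of_notMem h.2.2, h.2.1.2]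
  · rintro ⟨S, e⟩ h
    simp only [Finset.mem_sigma] at h
    simp [Finset.insert_erase h.2]
  · rintro ⟨e, T⟩ h
    simp only [Finset.mem_sigma, Finset.mem_filter] at h
    simp [Finset.erase_insert h.2.2]
  · rintro ⟨S, e⟩ h
    rfl

theorem sum_mul_familyGenPoly_link {α : Type*} [Fintype α] (P : Finset α → Prop) (d : ℕ)
    (x v : α → ℝ) :
    ∑ i, v i * familyGenPoly (familyLink P i) d x =
      ∑ S ∈ Finset.univ.powersetCard (d + 1),
        if P S then ∑ e ∈ S, (∏ k ∈ S.erase e, x k) * v e else 0 := by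
  have h := sum_powersetCard_succ_sum_erase d
    (fun e T => if P (insert e T) then (∏ k ∈ T, x k) * v e else 0)
  refine (Eq.trans ?_ h.symm).trans ?_
  · refine Finset.sum_congr rfl fun e _ => ?_
    rw [familyGenPoly, Finset.mul_sum]
    refine Finset.sum_congr rfl fun T _ => ?_
    by_cases he : e ∈ T <;> simp [familyLink, he, mul_comm]
  · refine Finset.sum_congr rfl fun S _ => ?_
    rw [Finset.sum_congr rfl fun e he => by rw [Finset.insert_erase he]]
    split_ifs <;> simp

/-- Euler's identity for the generating polynomial. -/
theorem sum_self_mul_familyGenPoly_link {α : Type*} [Fintype α] (P : Finset α → Prop) (d : ℕ)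
    (x : α → ℝ) :
    ∑ i, x i * familyGenPoly (familyLink P i) d x = (d + 1) * familyGenPoly P (d + 1) x := by
  rw [sum_mul_familyGenPoly_link, familyGenPoly, Finset.mul_sum]
  refine Finset.sum_congr rfl fun S hS => ?_
  rw [Finset.sum_congr rfl fun e he => Finset.prod_erase_mul S x he, Finset.sum_const,
    (Finset.mem_powersetCard.1 hS).2]
  split_ifs <;> simp

theorem hasDerivAt_familyGenPoly {α : Type*} [Fintype α] (P : Finset α → Prop) (d : ℕ)
    (x v : α → ℝ) (t : ℝ) :
    HasDerivAt (fun s : ℝ => familyGenPoly P (d + 1) fun e => x e + s * v e)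
      (∑ i, v i * familyGenPoly (familyLink P i) d fun e => x e + t * v e) t := by
  rw [sum_mul_familyGenPoly_link]
  refine HasDerivAt.fun_sum fun S _ => ?_
  split_ifs
  · refine HasDerivAt.fun_finsetProd fun e _ => ?_
    simpa using ((hasDerivAt_id t).mul_const (v e)).const_add (x e)
  · exact hasDerivAt_const _ _

theorem familyGenPoly_zero {α : Type*} [Fintype α] (P : Finset α → Prop) (x : α → ℝ) :
    familyGenPoly P 0 x = if P ∅ then 1 else 0 := by
  simp [familyGenPoly]

/-- The Hessian of the generating polynomial, with rows and columns scaled by the point. -/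
noncomputable def familyScaledHessian {α : Type*} [Fintype α] (P : Finset α → Prop) (d : ℕ)
    (x : α → ℝ) (i j : α) : ℝ :=
  x i * x j * familyGenPoly (familyLink (familyLink P i) j) d x

theorem familyScaledHessian_comm {α : Type*} [Fintype α] (P : Finset α → Prop) (d : ℕ)
    (x : α → ℝ) (i j : α) : familyScaledHessian P d x i j = familyScaledHessian P d x j i := by
  rw [familyScaledHessian, familyScaledHessian, familyLink_comm, mul_comm (x i)]

theorem familyScaledHessian_nonneg {α : Type*} [Fintype α] (P : Finset α → Prop) (d : ℕ)
    {x : α → ℝ} (hx : ∀ e, 0 ≤ x e) (i j : α) : 0 ≤ familyScaledHessian P d x i j :=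
  mul_nonneg (mul_nonneg (hx i) (hx j)) (familyGenPoly_nonneg _ _ hx)

theorem sum_familyScaledHessian {α : Type*} [Fintype α] (P : Finset α → Prop) (d : ℕ)
    (x : α → ℝ) (i : α) :
    ∑ j, familyScaledHessian P d x i j =
      (d + 1) * (x i * familyGenPoly (familyLink P i) (d + 1) x) := by
  simp only [familyScaledHessian, mul_assoc, ← Finset.mul_sum]
  rw [sum_self_mul_familyGenPoly_link]
  ring

theorem familyScaledHessian_pos_iff {α : Type*} [Fintype α] {P : Finset α → Prop}
    (hP : IsIndepFamily P) (d : ℕ) {x : α → ℝ} (hx : ∀ e, 0 < x e) (i j : α) :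
    0 < familyScaledHessian P d x i j ↔
      familyLink (familyLink P i) j ∅ ∧ ∃ S, S.card = d + 2 ∧ P S := by
  rw [familyScaledHessian, mul_pos_iff_of_pos_left (mul_pos (hx i) (hx j)),
    familyGenPoly_pos_iff _ _ hx]
  constructor
  · rintro ⟨S, hS, hPS⟩
    refine ⟨((hP.link i).link j).subset hPS (Finset.empty_subset S), _, ?_, hPS.2.2⟩
    rw [Finset.card_insert_of_notMem hPS.2.1, Finset.card_insert_of_notMem hPS.1, hS]
  · rintro ⟨hij, S, hS, hPS⟩
    have hji : i ∉ ({j} : Finset α) := by simpa [familyLink] using hij.2.1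
    obtain ⟨U, hU, hPU, hcU⟩ := hP.exists_superset_card_eq (S := {i, j})
      (by simpa using hij.2.2) hPS (by rw [Finset.card_insert_of_notMem hji]; simp; omega)
    have hiU : i ∈ U := hU (by simp)
    have hjU : j ∈ U.erase i := by
      rw [Finset.mem_erase]
      exact ⟨by simpa [eq_comm] using hji, hU (by simp)⟩
    refine ⟨(U.erase i).erase j, ?_, Finset.notMem_erase _ _, ?_, ?_⟩
    · rw [Finset.card_erase_of_mem hjU, Finset.card_erase_of_mem hiU]; omega
    · simp [Finset.insert_erase hjU]
    · rwa [Finset.insert_erase hjU, Finset.insert_erase hiU]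

/-- If `{i, k}` is independent then every nonloop `j` is independent of `i` or of `k`. -/
theorem IsIndepFamily.link_link_or {α : Type*} {P : Finset α → Prop} (hP : IsIndepFamily P)
    {i j k : α} (hj : P {j}) (hik : familyLink (familyLink P i) k ∅) :
    familyLink (familyLink P j) i ∅ ∨ familyLink (familyLink P j) k ∅ := by
  have hki : i ∉ ({k} : Finset α) := by simpa [familyLink] using hik.2.1
  obtain ⟨e, he, hej, hPe⟩ := hP.augment (T := {i, k}) hj (by simpa using hik.2.2)
    (by rw [Finset.card_insert_of_notMem hki]; simp)
  have hlink : familyLink (familyLink P j) e ∅ := by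
    refine ⟨by simp, by simpa [eq_comm] using hej, ?_⟩
    rw [Finset.insert_comm]
    exact hPe
  rw [Finset.mem_insert, Finset.mem_singleton] at he
  rcases he with rfl | rfl
  exacts [Or.inl hlink, Or.inr hlink]

theorem IsIndepFamily.singleton_of_link_link {α : Type*} {P : Finset α → Prop}
    (hP : IsIndepFamily P) {i j : α} (h : familyLink (familyLink P i) j ∅) : P {i} :=
  hP.subset h.2.2 (by simp)

/-- A sum over pairs with equal labels is a sum of squares. -/
theorem sum_sum_ite_eq_nonneg {ι κ : Type*} [Fintype ι] [Fintype κ] [DecidableEq κ]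
    (N : ι → κ) (y : ι → ℝ) :
    0 ≤ ∑ i, ∑ j, if N i = N j then y i * y j else 0 := by
  have h : ∑ i, ∑ j, (if N i = N j then y i * y j else 0) =
      ∑ c, (∑ i, if N i = c then y i else 0) ^ 2 := by
    simp_rw [pow_two, Finset.sum_mul_sum]
    rw [Finset.sum_comm]
    refine Eq.trans ?_ (Finset.sum_comm (s := Finset.univ) (t := Finset.univ)).symm
    rw [Finset.sum_comm]
    refine Finset.sum_congr rfl fun i _ => ?_
    rw [Finset.sum_comm]
    refine Finset.sum_congr rfl fun j _ => ?_
    simp [ite_mul, eq_comm]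
  rw [h]
  exact Finset.sum_nonneg fun c _ => sq_nonneg _

/-- The reverse Cauchy–Schwarz inequality for the degree-two generating polynomial. -/
theorem familyScaledHessian_zero_reverse_cauchySchwarz {α : Type*} [Fintype α]
    {P : Finset α → Prop} (hP : IsIndepFamily P) {x : α → ℝ} (hx : ∀ e, 0 < x e) (v : α → ℝ) :
    (∑ i, ∑ j, familyScaledHessian P 0 x i j * v i * v j) *
      (∑ i, ∑ j, familyScaledHessian P 0 x i j) ≤
      (∑ i, ∑ j, familyScaledHessian P 0 x i j * v j) ^ 2 := by
  set t := (∑ i, if P {i} then x i * v i else 0) / ∑ i, if P {i} then x i else 0 with ht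
  refine sum_mul_mul_sum_le_sq (familyScaledHessian_comm P 0 x)
    (familyScaledHessian_nonneg P 0 fun e => (hx e).le) v t ?_
  set y : α → ℝ := fun i => if P {i} then x i * (v i - t) else 0 with hy
  let N : α → Finset α := fun i => {k | familyLink (familyLink P i) k ∅}
  have hadj : ∀ i j, P {i} → P {j} → (familyLink (familyLink P i) j ∅ ↔ N i ≠ N j) := by
    intro i j hi hj
    constructor
    · intro hij hN
      have h : j ∈ N j := hN ▸ (by simpa [N] using hij)
      simp [N, familyLink] at h
    · contrapose
      intro hij
      have hji : ¬familyLink (familyLink P j) i ∅ := by rwa [familyLink_comm]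
      ext k
      simp only [N, Finset.mem_filter_univ]
      exact ⟨fun h => (hP.link_link_or hj h).resolve_left hji,
        fun h => (hP.link_link_or hi h).resolve_left hij⟩
  have hterm : ∀ i j, familyScaledHessian P 0 x i j * (v i - t) * (v j - t) =
      y i * y j - if N i = N j then y i * y j else 0 := by
    intro i j
    rw [familyScaledHessian, familyGenPoly_zero]
    by_cases hi : P {i}
    · by_cases hj : P {j}
      · have := hadj i j hi hj
        by_cases h : N i = N j
        · rw [if_neg (by simpa [h] using this), if_pos h]; ring
        · rw [if_pos (this.2 h), if_neg h]
          simp only [hy, hi, hj, if_true]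
          ring
      · have h : ¬familyLink (familyLink P i) j ∅ := by
          rw [familyLink_comm]
          exact fun h => hj (hP.singleton_of_link_link h)
        simp [h, hy, hj]
    · have h : ¬familyLink (familyLink P i) j ∅ := fun h => hi (hP.singleton_of_link_link h)
      simp [h, hy, hi]
  have hysum : ∑ i, y i = 0 := by
    have h1 : ∑ i, y i = (∑ i, if P {i} then x i * v i else 0) -
        t * ∑ i, if P {i} then x i else 0 := by
      rw [Finset.mul_sum, ← Finset.sum_sub_distrib]
      refine Finset.sum_congr rfl fun i _ => ?_
      by_cases hi : P {i} <;> simp [hy, hi]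
      ring
    have h2 : (∑ i, if P {i} then x i else 0) = 0 → ∀ i, ¬P {i} := by
      intro h i hi
      have h3 := (Finset.sum_eq_zero_iff_of_nonneg fun i _ => by
        split_ifs
        exacts [(hx i).le, le_rfl]).1 h i (Finset.mem_univ i)
      rw [if_pos hi] at h3
      exact (hx i).ne' h3
    rw [h1]
    by_cases h : (∑ i, if P {i} then x i else 0) = 0
    · simp [h2 h]
    · rw [ht, div_mul_cancel₀ _ h, sub_self]
  simp_rw [hterm, Finset.sum_sub_distrib]
  rw [← Finset.sum_mul_sum, hysum, mul_zero, zero_sub]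
  exact neg_nonpos.2 (sum_sum_ite_eq_nonneg N y)

/-- The scaled Hessian of the generating polynomial of an independence family satisfies the
reverse Cauchy–Schwarz inequality on the positive orthant. -/
theorem familyScaledHessian_reverse_cauchySchwarz {α : Type*} [Fintype α] {P : Finset α → Prop}
    (hP : IsIndepFamily P) (d : ℕ) {x : α → ℝ} (hx : ∀ e, 0 < x e) (v : α → ℝ) :
    (∑ i, ∑ j, familyScaledHessian P d x i j * v i * v j) *
      (∑ i, ∑ j, familyScaledHessian P d x i j) ≤
      (∑ i, ∑ j, familyScaledHessian P d x i j * v j) ^ 2 := by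
  induction d generalizing P v with
  | zero => exact familyScaledHessian_zero_reverse_cauchySchwarz hP hx v
  | succ d ih =>
    have hx0 : ∀ e, 0 ≤ x e := fun e => (hx e).le
    have hrow : ∀ i, 0 < ∑ k, familyScaledHessian P (d + 1) x i k →
        ∃ k, 0 < familyScaledHessian P (d + 1) x i k := fun i hi => by
      obtain ⟨k, -, hk⟩ := (Finset.sum_pos_iff_of_nonneg fun k _ =>
        familyScaledHessian_nonneg P (d + 1) hx0 i k).1 hi
      exact ⟨k, hk⟩
    refine sum_mul_mul_sum_le_sq_of_local (c := d + 1) (by positivity)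
      (T := fun k i j => x k * familyScaledHessian (familyLink P k) d x i j)
      (familyScaledHessian_comm P (d + 1) x) (familyScaledHessian_nonneg P (d + 1) hx0)
      ?_ (fun k i j => mul_nonneg (hx0 k) (familyScaledHessian_nonneg _ d hx0 i j)) ?_ ?_ ?_ v
    · intro i j hi hj
      obtain ⟨k, hk⟩ := hrow i hi
      obtain ⟨l, hl⟩ := hrow j hj
      obtain ⟨hik, hS⟩ := (familyScaledHessian_pos_iff hP _ hx i k).1 hk
      have hPj := hP.singleton_of_link_link ((familyScaledHessian_pos_iff hP _ hx j l).1 hl).1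
      rcases hP.link_link_or hPj hik with h | h
      · rw [familyLink_comm] at h
        exact Or.inl ((familyScaledHessian_pos_iff hP _ hx i j).2 ⟨h, hS⟩)
      · rw [familyLink_comm] at h
        exact Or.inr ⟨k, hk, (familyScaledHessian_pos_iff hP _ hx k j).2 ⟨h, hS⟩⟩
    · intro i j
      have h := sum_self_mul_familyGenPoly_link (familyLink (familyLink P i) j) d x
      have hcomm : ∀ k, familyLink (familyLink (familyLink P k) i) j =
          familyLink (familyLink (familyLink P i) j) k := fun k => by
        rw [familyLink_comm P k i, familyLink_comm (familyLink P i) k j]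
      simp only [familyScaledHessian, hcomm]
      rw [mul_left_comm, ← h, Finset.mul_sum]
      exact Finset.sum_congr rfl fun k _ => by ring
    · intro k j
      rw [← Finset.mul_sum, Finset.sum_congr rfl fun i _ => familyScaledHessian_comm _ d x i j,
        sum_familyScaledHessian, familyScaledHessian]
      ring
    · intro k u
      have h := ih (hP.link k) u
      simp only [mul_assoc, ← Finset.mul_sum] at h ⊢
      nlinarith [mul_le_mul_of_nonneg_left h (sq_nonneg (x k))]

/-- Differential form of the log-concavity of the generating polynomial. -/
theorem familyGenPoly_secondDeriv_mul_le {α : Type*} [Fintype α] {P : Finset α → Prop}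
    (hP : IsIndepFamily P) (d : ℕ) {x : α → ℝ} (hx : ∀ e, 0 < x e) (v : α → ℝ) :
    (∑ i, v i * ∑ j, v j * familyGenPoly (familyLink (familyLink P i) j) d x) *
      familyGenPoly P (d + 2) x ≤ (∑ i, v i * familyGenPoly (familyLink P i) (d + 1) x) ^ 2 := by
  have h := familyScaledHessian_reverse_cauchySchwarz hP d hx fun e => v e / x e
  have h1 : ∑ i, ∑ j, familyScaledHessian P d x i j * (v i / x i) * (v j / x j) =
      ∑ i, v i * ∑ j, v j * familyGenPoly (familyLink (familyLink P i) j) d x := by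
    refine Finset.sum_congr rfl fun i _ => ?_
    rw [Finset.mul_sum]
    refine Finset.sum_congr rfl fun j _ => ?_
    have := (hx i).ne'
    have := (hx j).ne'
    rw [familyScaledHessian]
    field_simp
  have h2 : ∑ i, ∑ j, familyScaledHessian P d x i j =
      (d + 1) * ((d + 2) * familyGenPoly P (d + 2) x) := by
    simp_rw [sum_familyScaledHessian, ← Finset.mul_sum]
    rw [sum_self_mul_familyGenPoly_link]
    push_cast
    ring
  have h3 : ∑ i, ∑ j, familyScaledHessian P d x i j * (v j / x j) =
      (d + 1) * ∑ i, v i * familyGenPoly (familyLink P i) (d + 1) x := by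
    rw [Finset.sum_comm, Finset.mul_sum]
    refine Finset.sum_congr rfl fun j _ => ?_
    rw [← Finset.sum_mul, Finset.sum_congr rfl fun i _ => familyScaledHessian_comm P d x i j,
      sum_familyScaledHessian]
    have := (hx j).ne'
    field_simp
  rw [h1, h2, h3] at h
  generalize (∑ i, v i * ∑ j, v j * familyGenPoly (familyLink (familyLink P i) j) d x) = q at h ⊢
  generalize (∑ i, v i * familyGenPoly (familyLink P i) (d + 1) x) = p at h ⊢
  generalize familyGenPoly P (d + 2) x = f at h ⊢
  have hd : (0 : ℝ) < d + 1 := by positivity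
  have h4 : (d + 2) * (q * f) ≤ (d + 1) * p ^ 2 := by
    refine le_of_mul_le_mul_left ?_ hd
    linarith
  have h5 : (d + 2) * (q * f) ≤ (d + 2) * p ^ 2 := by linarith [sq_nonneg p]
  exact le_of_mul_le_mul_left h5 (by positivity)

/-- A positive function whose logarithm has nonpositive second derivative is bounded below on
`[0, 1]` by any common lower bound of its end values. -/
theorem le_of_secondDeriv_mul_le_sq {g g' g'' : ℝ → ℝ}
    (hpos : ∀ t ∈ Set.Icc (0 : ℝ) 1, 0 < g t)
    (hg : ∀ t ∈ Set.Icc (0 : ℝ) 1, HasDerivAt g (g' t) t)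
    (hg' : ∀ t ∈ Set.Icc (0 : ℝ) 1, HasDerivAt g' (g'' t) t)
    (h : ∀ t ∈ Set.Icc (0 : ℝ) 1, g'' t * g t ≤ g' t ^ 2)
    {a t : ℝ} (ht : t ∈ Set.Icc (0 : ℝ) 1) (h0 : a ≤ g 0) (h1 : a ≤ g 1) : a ≤ g t := by
  have hlog : ConcaveOn ℝ (Set.Icc (0 : ℝ) 1) fun s => Real.log (g s) := by
    refine concaveOn_of_hasDerivWithinAt2_nonpos (convex_Icc 0 1)
      (f' := fun s => g' s / g s) (f'' := fun s => (g'' s * g s - g' s * g' s) / g s ^ 2)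
      (fun s hs => ((hg s hs).log (hpos s hs).ne').continuousAt.continuousWithinAt)
      (fun s hs => ?_) (fun s hs => ?_) fun s hs => ?_
    all_goals replace hs := interior_subset hs
    · exact ((hg s hs).log (hpos s hs).ne').hasDerivWithinAt
    · exact ((hg' s hs).div (hg s hs) (hpos s hs).ne').hasDerivWithinAt
    · exact div_nonpos_of_nonpos_of_nonneg (by nlinarith [h s hs]) (sq_nonneg _)
  have h0' : (0 : ℝ) ∈ Set.Icc (0 : ℝ) 1 := by simp
  have h1' : (1 : ℝ) ∈ Set.Icc (0 : ℝ) 1 := by simp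
  have hmin := hlog.min_le_of_mem_Icc h0' h1' ht
  rcases min_le_iff.1 hmin with hm | hm
  · exact h0.trans ((Real.log_le_log_iff (hpos 0 h0') (hpos t ht)).1 hm)
  · exact h1.trans ((Real.log_le_log_iff (hpos 1 h1') (hpos t ht)).1 hm)

/-- Quasi-concavity of the generating polynomial along segments in the positive orthant. -/
theorem le_familyGenPoly_segment {α : Type*} [Fintype α] {P : Finset α → Prop}
    (hP : IsIndepFamily P) (d : ℕ) (hd : ∃ S, S.card = d + 1 ∧ P S) {x y : α → ℝ}
    (hx : ∀ e, 0 < x e) (hy : ∀ e, 0 < y e) {a t : ℝ} (ht : t ∈ Set.Icc (0 : ℝ) 1)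
    (hax : a ≤ familyGenPoly P (d + 1) x) (hay : a ≤ familyGenPoly P (d + 1) y) :
    a ≤ familyGenPoly P (d + 1) fun e => x e + t * (y e - x e) := by
  have hz : ∀ s ∈ Set.Icc (0 : ℝ) 1, ∀ e, 0 < x e + s * (y e - x e) := by
    rintro s ⟨hs0, hs1⟩ e
    rcases hs0.eq_or_lt with rfl | hs
    · simpa using hx e
    · nlinarith [mul_pos hs (hy e), mul_nonneg (sub_nonneg.2 hs1) (hx e).le]
  refine le_of_secondDeriv_mul_le_sq
    (g := fun s => familyGenPoly P (d + 1) fun e => x e + s * (y e - x e))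
    (g' := fun s => ∑ i, (y i - x i) * familyGenPoly (familyLink P i) d
      fun e => x e + s * (y e - x e))
    (g'' := fun s => match d with
      | 0 => 0
      | d + 1 => ∑ i, (y i - x i) * ∑ j, (y j - x j) *
          familyGenPoly (familyLink (familyLink P i) j) d fun e => x e + s * (y e - x e))
    (fun s hs => (familyGenPoly_pos_iff P _ (hz s hs)).2 hd)
    (fun s _ => hasDerivAt_familyGenPoly P d x (fun e => y e - x e) s) (fun s _ => ?_)
    (fun s hs => ?_) ht (by simpa using hax) (by simpa using hay)
  · cases d with
    | zero => simpa only [familyGenPoly_zero] using hasDerivAt_const s _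
    | succ d =>
      exact HasDerivAt.fun_sum fun i _ =>
        (hasDerivAt_familyGenPoly (familyLink P i) d x (fun e => y e - x e) s).const_mul _
  · cases d with
    | zero => simpa using sq_nonneg _
    | succ d => exact familyGenPoly_secondDeriv_mul_le hP d (hz s hs) fun e => y e - x e

theorem continuous_familyGenPoly {α : Type*} [Fintype α] (P : Finset α → Prop) (d : ℕ) :
    Continuous (familyGenPoly P d) := by
  refine continuous_finsetSum _ fun S _ => ?_
  split_ifs
  · fun_prop
  · exact continuous_const

/-- The superlevel sets of the generating polynomial of an independence family in the nonnegative
orthant are convex. -/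
theorem convex_superlevel_familyGenPoly {α : Type*} [Fintype α] {P : Finset α → Prop}
    (hP : IsIndepFamily P) (d : ℕ) (hd : ∃ S, S.card = d + 1 ∧ P S) (a : ℝ) :
    Convex ℝ {x : α → ℝ | (∀ e, 0 ≤ x e) ∧ a ≤ familyGenPoly P (d + 1) x} := by
  rintro x ⟨hx, hax⟩ y ⟨hy, hay⟩ s t hs ht hst
  refine ⟨fun e => add_nonneg (mul_nonneg hs (hx e)) (mul_nonneg ht (hy e)), ?_⟩
  have hpert : ∀ ε ∈ Set.Ioi (0 : ℝ),
      a ≤ familyGenPoly P (d + 1) fun e => s * x e + t * y e + ε := by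
    intro ε hε
    have hε : 0 < ε := hε
    have h := le_familyGenPoly_segment hP d hd (x := fun e => x e + ε) (y := fun e => y e + ε)
      (fun e => add_pos_of_nonneg_of_pos (hx e) hε)
      (fun e => add_pos_of_nonneg_of_pos (hy e) hε) ⟨ht, by linarith⟩
      (hax.trans (familyGenPoly_mono P _ hx fun e => by linarith))
      (hay.trans (familyGenPoly_mono P _ hy fun e => by linarith))
    convert h using 2
    funext e
    rw [← eq_sub_iff_add_eq] at hst
    rw [hst]
    ring
  have hcont : Continuous fun ε : ℝ =>
      familyGenPoly P (d + 1) fun e => s * x e + t * y e + ε :=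
    (continuous_familyGenPoly P (d + 1)).comp (by fun_prop)
  have hlim := (hcont.tendsto 0).mono_left (nhdsWithin_le_nhds (s := Set.Ioi (0 : ℝ)))
  have hle := ge_of_tendsto hlim (Filter.eventually_of_mem self_mem_nhdsWithin hpert)
  simp only [add_zero] at hle
  exact hle

/-- **Quasi-concavity of the independent-set generating polynomial.** For every `a ≥ 0`,
the superlevel set `{x ∈ ℝ_{≥0}^E : f_{M,K}(x) ≥ a}` is convex. -/
theorem matroid_indepGenPoly_quasiConcave {α : Type*} [Fintype α] (M : Matroid α)
    (hE : M.E = Set.univ) (K : ℕ) (hK : 1 ≤ K)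
    (hrank : ∃ I : Finset α, M.Indep (I : Set α) ∧ I.card = K)
    (a : ℝ) (ha : 0 ≤ a) :
    Convex ℝ {x : α → ℝ | (∀ e, 0 ≤ x e) ∧ a ≤ indepGenPoly M K x} := by
  obtain ⟨d, rfl⟩ := Nat.exists_eq_add_of_le' hK
  obtain ⟨I, hI, hcard⟩ := hrank
  exact convex_superlevel_familyGenPoly M.isIndepFamily d ⟨I, hcard, hI⟩ a
end

section
/- Let M be a matroid on a finite ground set E, let K be an integer with 1 ≤ K ≤ rank(M), and suppose that the automorphism group of M acts transitively on E. Let u denote the uniform distribution on E, i.e., u_e = 1/|E| for all e. Then for every probability distribution p on E one has F_{M,K}(p) ≤ F_{M,K}(u), where F_{M,K}(p) = K! · Σ_{S independent in M, |S| = K} Π_{e ∈ S} p_e. -/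
open Finset Classical

/-- `F_{M,K}(p) = K! · ∑_{S ∈ I(M), |S| = K} ∏_{e ∈ S} p_e`. -/
noncomputable def indepProb {α : Type*} [Fintype α] (M : Matroid α) (K : ℕ)
    (p : α → ℝ) : ℝ :=
  (K.factorial : ℝ) *
    ∑ S ∈ Finset.univ.powersetCard K, if M.Indep (S : Set α) then ∏ e ∈ S, p e else 0

/-- A multiset is independent if it has no repetition and its support is independent. -/
def IndepMultiset {α : Type*} (M : Matroid α) (s : Multiset α) : Prop :=
  s.Nodup ∧ M.Indep {x | x ∈ s}

/-- The sum over all `k`-tuples `v` of the weights `∏ p (v i)`, restricted to those tuples that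
extend the multiset `s` to an independent multiset. -/
noncomputable def extensionSum {α : Type*} [Fintype α] (M : Matroid α) (p : α → ℝ) :
    ℕ → Multiset α → ℝ
  | 0, s => if IndepMultiset M s then 1 else 0
  | k + 1, s => ∑ i, p i * extensionSum M p k (i ::ₘ s)

section Multisets

variable {α : Type*} {M : Matroid α}

lemma IndepMultiset.of_cons {a : α} {s : Multiset α} (h : IndepMultiset M (a ::ₘ s)) :
    IndepMultiset M s :=
  ⟨(Multiset.nodup_cons.1 h.1).2, h.2.subset fun _ hx => Multiset.mem_cons_of_mem hx⟩

lemma IndepMultiset.augment {s t : Multiset α} (hs : IndepMultiset M s) (ht : IndepMultiset M t)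
    (hst : s.card < t.card) : ∃ e ∈ t, IndepMultiset M (e ::ₘ s) := by
  have hs' : M.Indep (s.toFinset : Set α) := by
    convert hs.2 using 1; ext; simp
  have ht' : M.Indep (t.toFinset : Set α) := by
    convert ht.2 using 1; ext; simp
  have hlt : (s.toFinset : Set α).encard < (t.toFinset : Set α).encard := by
    rw [Set.encard_coe_eq_coe_finsetCard, Set.encard_coe_eq_coe_finsetCard,
      Multiset.toFinset_card_of_nodup hs.1, Multiset.toFinset_card_of_nodup ht.1]
    exact_mod_cast hst
  obtain ⟨e, he, hi⟩ := hs'.augment ht' hlt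
  simp only [Set.mem_sdiff, Finset.mem_coe, Multiset.mem_toFinset] at he
  refine ⟨e, he.1, Multiset.nodup_cons.2 ⟨he.2, hs.1⟩, ?_⟩
  convert hi using 1
  ext; simp

lemma IndepMultiset.exchange {i j a : α} {s : Multiset α}
    (hij : IndepMultiset M (i ::ₘ j ::ₘ s)) (ha : IndepMultiset M (a ::ₘ s)) :
    IndepMultiset M (i ::ₘ a ::ₘ s) ∨ IndepMultiset M (j ::ₘ a ::ₘ s) := by
  obtain ⟨e, he, hi⟩ := ha.augment hij (by simp)
  rw [Multiset.mem_cons, Multiset.mem_cons] at he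
  rcases he with rfl | rfl | he
  · exact Or.inl hi
  · exact Or.inr hi
  · exact absurd (Multiset.mem_cons_of_mem he) (Multiset.nodup_cons.1 hi.1).1

lemma indepMultiset_map {g : α ≃ α} (hg : ∀ S : Set α, M.Indep (g '' S) ↔ M.Indep S)
    (s : Multiset α) : IndepMultiset M (s.map g) ↔ IndepMultiset M s := by
  unfold IndepMultiset
  rw [Multiset.nodup_map_iff_of_injective g.injective, ← hg {x | x ∈ s}]
  have : {x | x ∈ s.map g} = g '' {x | x ∈ s} := by
    ext; simp only [Multiset.mem_map, Set.mem_ofPred_eq, Set.mem_image]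
  rw [this]

variable [Fintype α] {p : α → ℝ}

lemma extensionSum_nonneg (hp : ∀ i, 0 ≤ p i) (k : ℕ) (s : Multiset α) :
    0 ≤ extensionSum M p k s := by
  induction k generalizing s with
  | zero => unfold extensionSum; split_ifs <;> norm_num
  | succ k ih => exact Finset.sum_nonneg fun i _ => mul_nonneg (hp i) (ih _)

lemma exists_extension_of_extensionSum_ne_zero {k : ℕ} {s : Multiset α}
    (h : extensionSum M p k s ≠ 0) :
    IndepMultiset M s ∧ ∃ t, IndepMultiset M t ∧ t.card = s.card + k := by
  induction k generalizing s with
  | zero =>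
    have hs : IndepMultiset M s := by
      by_contra hs
      exact h (if_neg hs)
    exact ⟨hs, s, hs, rfl⟩
  | succ k ih =>
    obtain ⟨i, -, hi⟩ := Finset.exists_ne_zero_of_sum_ne_zero h
    obtain ⟨his, t, ht, hc⟩ := ih (right_ne_zero_of_mul hi)
    exact ⟨his.of_cons, t, ht, by rw [hc, Multiset.card_cons]; omega⟩

lemma extensionSum_pos (hp : ∀ i, 0 < p i) {k : ℕ} {s t : Multiset α} (hs : IndepMultiset M s)
    (ht : IndepMultiset M t) (hc : t.card = s.card + k) : 0 < extensionSum M p k s := by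
  induction k generalizing s with
  | zero => simp [extensionSum, hs]
  | succ k ih =>
    obtain ⟨e, -, he⟩ := hs.augment ht (by omega)
    refine Finset.sum_pos' (fun i _ => mul_nonneg (hp i).le
      (extensionSum_nonneg (fun i => (hp i).le) _ _)) ⟨e, Finset.mem_univ _, ?_⟩
    exact mul_pos (hp e) (ih he (by rw [hc, Multiset.card_cons]; omega))

lemma sum_powersetCard_insert (g : Finset α → ℝ) (k : ℕ) :
    ∑ i, ∑ S ∈ univ.powersetCard k with i ∉ S, g (insert i S) =
      (k + 1) * ∑ T ∈ univ.powersetCard (k + 1), g T := by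
  have h : ∀ T ∈ (univ : Finset α).powersetCard (k + 1), ((k : ℝ) + 1) * g T = ∑ _i ∈ T, g T := by
    intro T hT
    rw [Finset.sum_const, (Finset.mem_powersetCard.1 hT).2, nsmul_eq_mul]
    push_cast; rfl
  rw [Finset.mul_sum, Finset.sum_congr rfl h, Finset.sum_sigma', Finset.sum_sigma']
  refine Finset.sum_bij' (fun x _ => ⟨insert x.1 x.2, x.1⟩) (fun x _ => ⟨x.2, x.1.erase x.2⟩)
    ?_ ?_ ?_ ?_ ?_
  · rintro ⟨i, S⟩ h
    simp only [mem_sigma, mem_univ, mem_filter, mem_powersetCard_univ, true_and] at h ⊢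
    exact ⟨by rw [card_insert_of_notMem h.2, h.1], mem_insert_self _ _⟩
  · rintro ⟨T, i⟩ h
    simp only [mem_sigma, mem_univ, mem_filter, mem_powersetCard_univ, true_and] at h ⊢
    exact ⟨by rw [card_erase_of_mem h.2, h.1]; rfl, notMem_erase _ _⟩
  · rintro ⟨i, S⟩ h
    simp only [mem_sigma, mem_filter] at h
    rw [erase_insert h.2.2]
  · rintro ⟨T, i⟩ h
    simp only [mem_sigma] at h
    rw [insert_erase h.2]
  · rintro ⟨i, S⟩ h
    rfl

lemma extensionSum_eq_sum_powersetCard (k : ℕ) (s : Multiset α) :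
    extensionSum M p k s = k.factorial * ∑ S ∈ univ.powersetCard k,
      if IndepMultiset M (S.val + s) then ∏ e ∈ S, p e else 0 := by
  induction k generalizing s with
  | zero => simp [extensionSum]
  | succ k ih =>
    have key := sum_powersetCard_insert
      (fun T => if IndepMultiset M (T.val + s) then ∏ e ∈ T, p e else 0) k
    rw [Nat.factorial_succ, Nat.cast_mul, mul_comm ((k + 1 : ℕ) : ℝ), mul_assoc, Nat.cast_succ,
      ← key, Finset.mul_sum]
    refine Finset.sum_congr rfl fun i _ => ?_
    rw [ih, Finset.sum_filter, mul_left_comm, Finset.mul_sum]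
    congr 1
    refine Finset.sum_congr rfl fun S _ => ?_
    by_cases hi : i ∈ S
    · have : ¬ IndepMultiset M (S.val + i ::ₘ s) := fun h => by
        have h1 := h.1
        rw [Multiset.add_cons, Multiset.nodup_cons] at h1
        exact h1.1 (Multiset.mem_add.2 (Or.inl hi))
      rw [if_neg this, if_neg (not_not.2 hi), mul_zero]
    · rw [if_pos hi, Finset.insert_val_of_notMem hi, Multiset.add_cons, Multiset.cons_add,
        Finset.prod_insert hi, mul_ite, mul_zero]

lemma indepProb_eq_extensionSum (k : ℕ) : indepProb M k p = extensionSum M p k 0 := by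
  rw [indepProb, extensionSum_eq_sum_powersetCard]
  congr 1
  refine Finset.sum_congr rfl fun S _ => ?_
  have : IndepMultiset M (S.val + 0) ↔ M.Indep (S : Set α) := by
    rw [add_zero]; exact and_iff_right S.nodup
  simp only [this]

lemma extensionSum_map {g : α ≃ α} (hg : ∀ S : Set α, M.Indep (g '' S) ↔ M.Indep S)
    (c : ℝ) (k : ℕ) (s : Multiset α) :
    extensionSum M (fun _ => c) k (s.map g) = extensionSum M (fun _ => c) k s := by
  induction k generalizing s with
  | zero => simp [extensionSum, indepMultiset_map hg]
  | succ k ih =>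
    unfold extensionSum
    rw [← Equiv.sum_comp g]
    refine Finset.sum_congr rfl fun i _ => ?_
    rw [← Multiset.map_cons, ih]

lemma hasDerivAt_extensionSum (q v : α → ℝ) (k : ℕ) (s : Multiset α) (t : ℝ) :
    HasDerivAt (fun t => extensionSum M (fun i => q i + t * v i) (k + 1) s)
      ((k + 1) * ∑ i, v i * extensionSum M (fun i => q i + t * v i) k (i ::ₘ s)) t := by
  induction k generalizing s with
  | zero =>
    have h : HasDerivAt (fun t : ℝ => ∑ i, (q i + t * v i) *
        extensionSum M (fun i => q i + t * v i) 0 (i ::ₘ s))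
        (∑ i, v i * extensionSum M (fun i => q i + t * v i) 0 (i ::ₘ s)) t := by
      refine HasDerivAt.fun_sum fun i _ => ?_
      have := (((hasDerivAt_id t).mul_const (v i)).const_add (q i)).mul_const
        (if IndepMultiset M (i ::ₘ s) then (1 : ℝ) else 0)
      simpa [extensionSum] using this
    simpa [extensionSum] using h
  | succ k ih =>
    have h : HasDerivAt (fun t : ℝ => ∑ i, (q i + t * v i) *
        extensionSum M (fun i => q i + t * v i) (k + 1) (i ::ₘ s))
        (∑ i, (v i * extensionSum M (fun i => q i + t * v i) (k + 1) (i ::ₘ s) +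
          (q i + t * v i) * ((k + 1) * ∑ j, v j *
            extensionSum M (fun i => q i + t * v i) k (j ::ₘ i ::ₘ s)))) t := by
      refine HasDerivAt.fun_sum fun i _ => ?_
      have := (((hasDerivAt_id t).mul_const (v i)).const_add (q i)).fun_mul (ih (i ::ₘ s))
      simpa using this
    refine h.congr_deriv ?_
    have hs : ∑ i, (q i + t * v i) * ((k + 1) * ∑ j, v j *
            extensionSum M (fun i => q i + t * v i) k (j ::ₘ i ::ₘ s)) =
        (k + 1) * ∑ j, v j * extensionSum M (fun i => q i + t * v i) (k + 1) (j ::ₘ s) := by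
      simp only [extensionSum, Finset.mul_sum]
      rw [Finset.sum_comm]
      refine Finset.sum_congr rfl fun i _ => Finset.sum_congr rfl fun j _ => ?_
      rw [Multiset.cons_swap]
      ring
    rw [Finset.sum_add_distrib, hs]
    push_cast
    ring

end Multisets

section HessianSignature

/-- The complete multipartite form on `W` with parts the fibres of `c` is nonpositive on the
orthogonal complement of a positive vector. -/
lemma multipartite_nonpos {α β : Type*} [Fintype β] [DecidableEq β]
    (W : Finset α) (c : α → β) (p : α → ℝ)
    (hp : ∀ i, 0 < p i) (x : α → ℝ)
    (hx : ∑ i ∈ W, x i * ∑ j ∈ W, (if c i = c j then 0 else 1) * p j = 0) :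
    ∑ i ∈ W, x i * ∑ j ∈ W, (if c i = c j then 0 else 1) * x j ≤ 0 := by
  have hform : ∀ a b : α → ℝ, ∑ i ∈ W, a i * ∑ j ∈ W, (if c i = c j then 0 else 1) * b j =
      (∑ i ∈ W, a i) * (∑ i ∈ W, b i) -
        ∑ k, (∑ i ∈ W with c i = k, a i) * (∑ i ∈ W with c i = k, b i) := by
    intro a b
    have h1 : ∑ k, (∑ i ∈ W with c i = k, a i) * (∑ i ∈ W with c i = k, b i) =
        ∑ i ∈ W, a i * ∑ j ∈ W, (if c i = c j then b j else 0) := by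
      rw [← Finset.sum_fiberwise W c]
      refine Finset.sum_congr rfl fun k _ => ?_
      rw [Finset.sum_mul]
      refine Finset.sum_congr rfl fun i hi => ?_
      rw [← Finset.sum_filter, (Finset.mem_filter.1 hi).2]
      simp only [eq_comm]
    rw [h1, Finset.sum_mul, ← Finset.sum_sub_distrib]
    refine Finset.sum_congr rfl fun i _ => ?_
    rw [← mul_sub, ← Finset.sum_sub_distrib]
    congr 1
    refine Finset.sum_congr rfl fun j _ => ?_
    split_ifs <;> ring
  rw [hform] at hx ⊢
  set X := fun k => ∑ i ∈ W with c i = k, x i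
  set P := fun k => ∑ i ∈ W with c i = k, p i
  have hP : ∀ k, 0 ≤ P k := fun k => Finset.sum_nonneg fun i _ => (hp i).le
  have hPsum : ∑ k, P k = ∑ i ∈ W, p i := Finset.sum_fiberwise W c p
  have hcs := Finset.sum_mul_sq_le_sq_mul_sq univ X P
  have hPsq : ∑ k, P k ^ 2 ≤ (∑ i ∈ W, p i) ^ 2 := by
    rw [← hPsum]
    exact Finset.sum_sq_le_sq_sum_of_nonneg fun k _ => hP k
  rcases W.eq_empty_or_nonempty with rfl | hW
  · simp
  have hS : 0 < ∑ i ∈ W, p i := Finset.sum_pos (fun i _ => hp i) hW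
  have hXsq : 0 ≤ ∑ k, X k ^ 2 := Finset.sum_nonneg fun k _ => sq_nonneg _
  have h1 : (∑ i ∈ W, x i) ^ 2 * (∑ i ∈ W, p i) ^ 2 ≤ (∑ k, X k ^ 2) * (∑ i ∈ W, p i) ^ 2 := by
    rw [← mul_pow, sub_eq_zero.1 hx]
    exact hcs.trans (mul_le_mul_of_nonneg_left hPsq hXsq)
  have h2 := le_of_mul_le_mul_right h1 (by positivity)
  have h3 : ∑ k, X k * X k = ∑ k, X k ^ 2 := Finset.sum_congr rfl fun k _ => (sq _).symm
  rw [h3]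
  linarith [sq (∑ i ∈ W, x i)]

variable {α : Type*} [Fintype α]

lemma Matrix.exists_mulVec_eq_of_forall_dotProduct_eq_zero {L : Matrix α α ℝ} (hL : L.IsSymm)
    (b : α → ℝ) (hb : ∀ y, L.mulVec y = 0 → y ⬝ᵥ b = 0) : ∃ z, L.mulVec z = b := by
  have hs : L.toEuclideanLin.IsSymmetric := by
    rw [Matrix.isSymmetric_toEuclideanLin_iff]
    ext i j
    simpa using hL.apply i j
  have hmem : WithLp.toLp 2 b ∈ L.toEuclideanLin.range := by
    rw [← Submodule.orthogonal_orthogonal L.toEuclideanLin.range, hs.orthogonal_range,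
      Submodule.mem_orthogonal]
    intro y hy
    have hy' : L.mulVec y.ofLp = 0 := by
      have := congrArg WithLp.ofLp (LinearMap.mem_ker.1 hy)
      simpa using this
    rw [EuclideanSpace.inner_eq_star_dotProduct]
    simpa [dotProduct_comm] using hb _ hy'
  obtain ⟨z, hz⟩ := hmem
  exact ⟨z.ofLp, by simpa using congrArg WithLp.ofLp hz⟩

/-- The quadratic form of the weighted graph Laplacian. -/
lemma sum_mul_sum_laplacian (H : α → α → ℝ) (hsymm : ∀ i j, H i j = H j i) (p : α → ℝ)
    (hp : ∀ i, 0 < p i) (y : α → ℝ) :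
    ∑ i, y i * ((∑ j, H i j * p j) / p i * y i - ∑ j, H i j * y j) =
      (∑ i, ∑ j, H i j * p i * p j * (y i / p i - y j / p j) ^ 2) / 2 := by
  have h1 : ∑ i, ∑ j, H i j * p i * p j * (y i / p i - y j / p j) ^ 2 =
      ∑ i, ∑ j, H i j * p j * y i ^ 2 / p i + ∑ i, ∑ j, H i j * p i * y j ^ 2 / p j -
        2 * ∑ i, ∑ j, H i j * y i * y j := by
    simp only [Finset.mul_sum, ← Finset.sum_add_distrib, ← Finset.sum_sub_distrib]
    refine Finset.sum_congr rfl fun i _ => Finset.sum_congr rfl fun j _ => ?_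
    have := (hp i).ne'
    have := (hp j).ne'
    field_simp
    ring
  have h2 : ∑ i, ∑ j, H i j * p i * y j ^ 2 / p j = ∑ i, ∑ j, H i j * p j * y i ^ 2 / p i := by
    rw [Finset.sum_comm]
    refine Finset.sum_congr rfl fun i _ => Finset.sum_congr rfl fun j _ => ?_
    rw [hsymm]
  rw [h1, h2, ← two_mul, ← mul_sub, mul_div_cancel_left₀ _ two_ne_zero, ← Finset.sum_sub_distrib]
  refine Finset.sum_congr rfl fun i _ => ?_
  rw [mul_sub, Finset.mul_sum, Finset.sum_div, Finset.sum_mul, Finset.mul_sum]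
  congr 1 <;> refine Finset.sum_congr rfl fun j _ => by ring

/-- A nonnegative symmetric form `H` whose graph is connected with diameter at most two and which
satisfies a Bochner-type inequality at `p` is nonpositive on the `H`-orthogonal complement
of `p`. -/
lemma sum_mul_sum_nonpos_of_bochner (H : α → α → ℝ) (hsymm : ∀ i j, H i j = H j i)
    (hnn : ∀ i j, 0 ≤ H i j) (p : α → ℝ) (hp : ∀ i, 0 < p i)
    (hconn : ∀ i j, ∑ k, H i k * p k ≠ 0 → ∑ k, H j k * p k ≠ 0 →
      H i j ≠ 0 ∨ ∃ m, H i m ≠ 0 ∧ H j m ≠ 0)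
    (hbochner : ∀ y : α → ℝ, ∑ i, y i * ∑ j, H i j * y j ≤
      ∑ i, p i * (∑ j, H i j * y j) ^ 2 / ∑ j, H i j * p j)
    (x : α → ℝ) (hx : ∑ i, x i * ∑ j, H i j * p j = 0) :
    ∑ i, x i * ∑ j, H i j * x j ≤ 0 := by
  set d : α → ℝ := fun i => ∑ j, H i j * p j with hd
  have hd0 : ∀ i, 0 ≤ d i := fun i => Finset.sum_nonneg fun j _ => mul_nonneg (hnn i j) (hp j).le
  have hzero : ∀ i, d i = 0 → ∀ j, H i j = 0 := by
    intro i hi j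
    have := (Finset.sum_eq_zero_iff_of_nonneg
      (fun j _ => mul_nonneg (hnn i j) (hp j).le)).1 hi j (Finset.mem_univ j)
    exact (mul_eq_zero.1 this).resolve_right (hp j).ne'
  let L : Matrix α α ℝ := Matrix.diagonal (fun i => d i / p i) - Matrix.of H
  have hLmul : ∀ y i, L.mulVec y i = d i / p i * y i - ∑ j, H i j * y j := by
    intro y i
    rw [Matrix.sub_mulVec, Pi.sub_apply, Matrix.mulVec_diagonal]
    rfl
  have hform := sum_mul_sum_laplacian H hsymm p hp
  have hterm : ∀ y : α → ℝ, ∀ i j, 0 ≤ H i j * p i * p j * (y i / p i - y j / p j) ^ 2 :=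
    fun y i j => mul_nonneg (mul_nonneg (mul_nonneg (hnn i j) (hp i).le) (hp j).le) (sq_nonneg _)
  have hpsd : ∀ y : α → ℝ, 0 ≤ ∑ i, y i * (d i / p i * y i - ∑ j, H i j * y j) := by
    intro y
    rw [hform]
    exact div_nonneg (Finset.sum_nonneg fun i _ => Finset.sum_nonneg fun j _ => hterm y i j)
      zero_le_two
  have hLsymm : L.IsSymm := by
    refine (Matrix.isSymm_diagonal _).sub ?_
    ext i j
    exact hsymm j i
  obtain ⟨z, hz⟩ : ∃ z, L.mulVec z = fun i => d i / p i * x i := by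
    refine Matrix.exists_mulVec_eq_of_forall_dotProduct_eq_zero hLsymm _ fun y hy => ?_
    have h0 : ∑ i, y i * (d i / p i * y i - ∑ j, H i j * y j) = 0 :=
      Finset.sum_eq_zero fun i _ => by rw [← hLmul, hy, Pi.zero_apply, mul_zero]
    rw [hform, div_eq_zero_iff, or_iff_left two_ne_zero, Finset.sum_eq_zero_iff_of_nonneg
      (fun i _ => Finset.sum_nonneg fun j _ => hterm y i j)] at h0
    have hadj : ∀ i j, H i j ≠ 0 → y i / p i = y j / p j := by
      intro i j hij
      have := (Finset.sum_eq_zero_iff_of_nonneg (fun j _ => hterm y i j)).1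
        (h0 i (Finset.mem_univ i)) j (Finset.mem_univ j)
      have h3 : H i j * p i * p j ≠ 0 := mul_ne_zero (mul_ne_zero hij (hp i).ne') (hp j).ne'
      exact sub_eq_zero.1 (pow_eq_zero_iff two_ne_zero |>.1 ((mul_eq_zero.1 this).resolve_left h3))
    have hconst : ∀ i j, d i ≠ 0 → d j ≠ 0 → y i / p i = y j / p j := by
      intro i j hi hj
      rcases hconn i j hi hj with h | ⟨m, him, hjm⟩
      · exact hadj i j h
      · rw [hadj i m him, hadj j m hjm]
    by_cases hall : ∀ i, d i = 0
    · simp [dotProduct, hall]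
    · push Not at hall
      obtain ⟨i₀, hi₀⟩ := hall
      have : y ⬝ᵥ (fun i => d i / p i * x i) = y i₀ / p i₀ * ∑ i, x i * d i := by
        rw [dotProduct, Finset.mul_sum]
        refine Finset.sum_congr rfl fun i _ => ?_
        by_cases hi : d i = 0
        · simp [hi]
        · rw [hconst i₀ i hi₀ hi]; ring
      rw [this, hx, mul_zero]
  have hz' : ∀ i, d i / p i * z i - ∑ j, H i j * z j = d i / p i * x i := fun i => by
    rw [← hLmul, hz]
  have hsum : ∀ a b : α → ℝ, ∑ i, a i * ∑ j, H i j * b j = ∑ i, b i * ∑ j, H i j * a j := by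
    intro a b
    simp only [Finset.mul_sum]
    rw [Finset.sum_comm]
    refine Finset.sum_congr rfl fun i _ => Finset.sum_congr rfl fun j _ => ?_
    rw [hsymm]; ring
  have h1 : ∑ i, z i * (d i / p i * z i - ∑ j, H i j * z j) ≤ ∑ i, x i * (d i / p i * x i) := by
    have hb := hbochner z
    have hrhs : ∑ i, p i * (∑ j, H i j * z j) ^ 2 / d i =
        ∑ i, (z i * ∑ j, H i j * z j - z i * (d i / p i * x i) + x i * (d i / p i * x i)) := by
      refine Finset.sum_congr rfl fun i _ => ?_
      have hHz : ∑ j, H i j * z j = d i / p i * z i - d i / p i * x i := by linarith [hz' i]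
      rw [hHz]
      by_cases hi : d i = 0
      · simp [hi]
      · have := (hp i).ne'
        field_simp
        ring
    rw [show ∑ i, p i * (∑ j, H i j * z j) ^ 2 / ∑ j, H i j * p j =
      ∑ i, p i * (∑ j, H i j * z j) ^ 2 / d i from rfl, hrhs, Finset.sum_add_distrib,
      Finset.sum_sub_distrib] at hb
    simp only [hz']
    linarith
  have h2 := hpsd (fun i => z i - x i)
  have h3 : ∑ i, (z i - x i) * (d i / p i * (z i - x i) - ∑ j, H i j * (z j - x j)) =
      ∑ i, z i * (d i / p i * z i - ∑ j, H i j * z j) - 2 * ∑ i, x i * (d i / p i * x i) +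
        (∑ i, x i * (d i / p i * x i) - ∑ i, x i * ∑ j, H i j * x j) := by
    have hxz : ∑ i, x i * (d i / p i * z i - ∑ j, H i j * z j) =
        ∑ i, x i * (d i / p i * x i) := by simp only [hz']
    have hzx : ∑ i, z i * (d i / p i * x i - ∑ j, H i j * x j) =
        ∑ i, x i * (d i / p i * x i) := by
      rw [← hxz]
      simp only [mul_sub, Finset.sum_sub_distrib, hsum z x]
      congr 1
      exact Finset.sum_congr rfl fun i _ => by ring
    have : ∑ i, (z i - x i) * (d i / p i * (z i - x i) - ∑ j, H i j * (z j - x j)) =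
        ∑ i, z i * (d i / p i * z i - ∑ j, H i j * z j) -
        ∑ i, z i * (d i / p i * x i - ∑ j, H i j * x j) -
        ∑ i, x i * (d i / p i * z i - ∑ j, H i j * z j) +
        ∑ i, x i * (d i / p i * x i - ∑ j, H i j * x j) := by
      rw [← Finset.sum_sub_distrib, ← Finset.sum_sub_distrib, ← Finset.sum_add_distrib]
      refine Finset.sum_congr rfl fun i _ => ?_
      simp only [mul_sub, Finset.sum_sub_distrib]
      ring
    rw [this, hzx, hxz]
    simp only [mul_sub, Finset.sum_sub_distrib]
    ring
  rw [h3] at h2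
  linarith

/-- A symmetric form which is nonpositive on the orthogonal complement of `p` satisfies the
reverse Cauchy-Schwarz inequality at `p`. -/
lemma reverse_cauchySchwarz (H : α → α → ℝ) (hsymm : ∀ i j, H i j = H j i)
    (hnn : ∀ i j, 0 ≤ H i j) (p : α → ℝ) (hp : ∀ i, 0 < p i)
    (hneg : ∀ x : α → ℝ, ∑ i, x i * ∑ j, H i j * p j = 0 → ∑ i, x i * ∑ j, H i j * x j ≤ 0)
    (x : α → ℝ) :
    (∑ i, x i * ∑ j, H i j * x j) * (∑ i, p i * ∑ j, H i j * p j) ≤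
      (∑ i, x i * ∑ j, H i j * p j) ^ 2 := by
  have hQ0 : 0 ≤ ∑ i, p i * ∑ j, H i j * p j := Finset.sum_nonneg fun i _ =>
    mul_nonneg (hp i).le (Finset.sum_nonneg fun j _ => mul_nonneg (hnn i j) (hp j).le)
  rcases hQ0.eq_or_lt with h0 | hpos
  · rw [← h0, mul_zero]
    exact sq_nonneg _
  have hsum : ∑ i, p i * ∑ j, H i j * x j = ∑ i, x i * ∑ j, H i j * p j := by
    simp only [Finset.mul_sum]
    rw [Finset.sum_comm]
    refine Finset.sum_congr rfl fun i _ => Finset.sum_congr rfl fun j _ => ?_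
    rw [hsymm]; ring
  set Q := ∑ i, p i * ∑ j, H i j * p j
  set B := ∑ i, x i * ∑ j, H i j * p j
  set c := B / Q
  have hc : c * Q = B := div_mul_cancel₀ _ hpos.ne'
  have h1 : ∑ i, (x i - c * p i) * ∑ j, H i j * p j = B - c * Q := by
    simp only [B, Q, Finset.mul_sum (s := univ) (a := c), ← Finset.sum_sub_distrib]
    exact Finset.sum_congr rfl fun i _ => by ring
  have h2 : ∑ i, (x i - c * p i) * ∑ j, H i j * (x j - c * p j) =
      ∑ i, x i * ∑ j, H i j * x j - c * B - c * ∑ i, p i * ∑ j, H i j * x j + c * (c * Q) := by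
    simp only [B, Q, Finset.mul_sum (s := univ) (a := c), ← Finset.sum_sub_distrib,
      ← Finset.sum_add_distrib]
    refine Finset.sum_congr rfl fun i _ => ?_
    have : ∑ j, H i j * (x j - c * p j) = ∑ j, H i j * x j - c * ∑ j, H i j * p j := by
      rw [Finset.mul_sum, ← Finset.sum_sub_distrib]
      exact Finset.sum_congr rfl fun j _ => by ring
    rw [this]; ring
  have h3 := hneg (fun i => x i - c * p i) (by rw [h1, hc, sub_self])
  rw [h2, hsum, hc] at h3
  calc _ ≤ c * B * Q := mul_le_mul_of_nonneg_right (by linarith) hpos.le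
    _ = B ^ 2 := by rw [mul_right_comm, hc, sq]

end HessianSignature

section LogConcavity

variable {α : Type*} [Fintype α] {M : Matroid α} {p : α → ℝ}

lemma extensionSum_hessian_nonpos_zero (hp : ∀ i, 0 < p i) (s : Multiset α) (x : α → ℝ)
    (hx : ∑ i, x i * ∑ j, extensionSum M p 0 (j ::ₘ i ::ₘ s) * p j = 0) :
    ∑ i, x i * ∑ j, extensionSum M p 0 (j ::ₘ i ::ₘ s) * x j ≤ 0 := by
  let W : Finset α := univ.filter fun i => IndepMultiset M (i ::ₘ s)
  let c : α → Finset α := fun i => W.filter fun j => ¬ IndepMultiset M (j ::ₘ i ::ₘ s)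
  have hself : ∀ i, ¬ IndepMultiset M (i ::ₘ i ::ₘ s) := fun i h =>
    (Multiset.nodup_cons.1 h.1).1 (Multiset.mem_cons_self i _)
  have htrans : ∀ i j l, j ∈ W → ¬ IndepMultiset M (j ::ₘ i ::ₘ s) →
      IndepMultiset M (l ::ₘ i ::ₘ s) → IndepMultiset M (l ::ₘ j ::ₘ s) := by
    intro i j l hj hij hl
    rcases hl.exchange (Finset.mem_filter.1 hj).2 with h | h
    · exact h
    · rw [Multiset.cons_swap] at h
      exact absurd h hij
  have hc : ∀ i ∈ W, ∀ j ∈ W, c i = c j ↔ ¬ IndepMultiset M (j ::ₘ i ::ₘ s) := by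
    intro i hi j hj
    constructor
    · intro h
      have : j ∈ c j := Finset.mem_filter.2 ⟨hj, hself j⟩
      rw [← h] at this
      exact (Finset.mem_filter.1 this).2
    · intro h
      have h' : ¬ IndepMultiset M (i ::ₘ j ::ₘ s) := by rwa [Multiset.cons_swap]
      refine Finset.filter_congr fun l _ => not_congr ⟨htrans i j l hj h, htrans j i l hi h'⟩
  have hred : ∀ y : α → ℝ, ∑ i, x i * ∑ j, extensionSum M p 0 (j ::ₘ i ::ₘ s) * y j =
      ∑ i ∈ W, x i * ∑ j ∈ W, (if c i = c j then 0 else 1) * y j := by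
    intro y
    have hW : ∀ i j, IndepMultiset M (j ::ₘ i ::ₘ s) → i ∈ W ∧ j ∈ W := fun i j h => by
      refine ⟨Finset.mem_filter.2 ⟨Finset.mem_univ _, h.of_cons⟩,
        Finset.mem_filter.2 ⟨Finset.mem_univ _, ?_⟩⟩
      rw [Multiset.cons_swap] at h
      exact h.of_cons
    symm
    refine (Finset.sum_congr rfl fun i hi => ?_).trans
      (Finset.sum_subset (Finset.subset_univ W) fun i _ hi => ?_)
    · congr 1
      refine (Finset.sum_congr rfl fun j hj => ?_).trans
        (Finset.sum_subset (Finset.subset_univ W) fun j _ hj => ?_)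
      · simp only [extensionSum, hc i hi j hj, ite_not]
      · have : ¬ IndepMultiset M (j ::ₘ i ::ₘ s) := fun h => hj (hW i j h).2
        rw [extensionSum, if_neg this, zero_mul]
    · refine mul_eq_zero_of_right _ (Finset.sum_eq_zero fun j _ => ?_)
      have : ¬ IndepMultiset M (j ::ₘ i ::ₘ s) := fun h => hi (hW i j h).1
      rw [extensionSum, if_neg this, zero_mul]
  rw [hred] at hx ⊢
  exact multipartite_nonpos W c p hp x hx

lemma extensionSum_hessian_nonpos (hp : ∀ i, 0 < p i) (k : ℕ) (s : Multiset α) (x : α → ℝ)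
    (hx : ∑ i, x i * ∑ j, extensionSum M p k (j ::ₘ i ::ₘ s) * p j = 0) :
    ∑ i, x i * ∑ j, extensionSum M p k (j ::ₘ i ::ₘ s) * x j ≤ 0 := by
  have hsymm : ∀ k s i j, extensionSum M p k (j ::ₘ i ::ₘ s) =
      extensionSum M p k (i ::ₘ j ::ₘ s) := fun k s i j => by rw [Multiset.cons_swap]
  have hnn : ∀ k s, 0 ≤ extensionSum M p k s := extensionSum_nonneg fun i => (hp i).le
  have hsucc : ∀ k s, ∑ j, extensionSum M p k (j ::ₘ s) * p j = extensionSum M p (k + 1) s :=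
    fun k s => Finset.sum_congr rfl fun j _ => mul_comm _ _
  induction k generalizing s x with
  | zero => exact extensionSum_hessian_nonpos_zero hp s x hx
  | succ k ih =>
    refine sum_mul_sum_nonpos_of_bochner (fun i j => extensionSum M p (k + 1) (j ::ₘ i ::ₘ s))
      (hsymm _ s) (fun i j => hnn _ _) p hp ?_ ?_ x hx
    · intro i j hi hj
      rw [hsucc] at hi hj
      obtain ⟨hi, t, ht, htc⟩ := exists_extension_of_extensionSum_ne_zero hi
      obtain ⟨hj, -⟩ := exists_extension_of_extensionSum_ne_zero hj
      simp only [Multiset.card_cons] at htc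
      have hne : ∀ a b, IndepMultiset M (a ::ₘ b ::ₘ s) →
          extensionSum M p (k + 1) (a ::ₘ b ::ₘ s) ≠ 0 := fun a b h =>
        (extensionSum_pos hp h ht (by simp only [Multiset.card_cons]; omega)).ne'
      obtain ⟨e, -, he⟩ := hi.augment ht (by simp only [Multiset.card_cons]; omega)
      rcases he.exchange hj with h | h
      · exact Or.inr ⟨e, hne _ _ he, hne _ _ h⟩
      · rw [Multiset.cons_swap] at h
        exact Or.inl (hne _ _ h)
    · intro y
      have hrcs := fun m => reverse_cauchySchwarz
        (fun i j => extensionSum M p k (j ::ₘ i ::ₘ m ::ₘ s)) (hsymm _ _) (fun i j => hnn _ _) p hp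
        (ih (m ::ₘ s)) y
      have hexp : ∑ i, y i * ∑ j, extensionSum M p (k + 1) (j ::ₘ i ::ₘ s) * y j =
          ∑ m, p m * ∑ i, y i * ∑ j, extensionSum M p k (j ::ₘ i ::ₘ m ::ₘ s) * y j := by
        simp only [extensionSum, Finset.mul_sum, Finset.sum_mul]
        symm
        refine Finset.sum_comm.trans (Finset.sum_congr rfl fun i _ => Finset.sum_comm.trans
          (Finset.sum_congr rfl fun j _ => Finset.sum_congr rfl fun m _ => ?_))
        rw [Multiset.cons_swap i m, Multiset.cons_swap j m]
        ring
      rw [hexp]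
      refine Finset.sum_le_sum fun m _ => ?_
      have h := hrcs m
      have hmix : ∀ z : α → ℝ, ∑ i, z i * ∑ j, extensionSum M p k (j ::ₘ i ::ₘ m ::ₘ s) * p j =
          ∑ j, extensionSum M p (k + 1) (j ::ₘ m ::ₘ s) * z j := fun z => by
        simp only [hsucc]
        exact Finset.sum_congr rfl fun j _ => mul_comm _ _
      simp only [hmix] at h
      rw [mul_div_assoc]
      refine mul_le_mul_of_nonneg_left ?_ (hp m).le
      have hD : 0 ≤ ∑ j, extensionSum M p (k + 1) (j ::ₘ m ::ₘ s) * p j :=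
        Finset.sum_nonneg fun j _ => mul_nonneg (hnn _ _) (hp j).le
      rcases hD.eq_or_lt with h0 | hpos
      · rw [← h0, div_zero]
        refine (Finset.sum_eq_zero fun i _ => ?_).le
        refine mul_eq_zero_of_right _ (Finset.sum_eq_zero fun j _ => ?_)
        have hi := (Finset.sum_eq_zero_iff_of_nonneg
          (fun j _ => mul_nonneg (hnn _ _) (hp j).le)).1 h0.symm i (Finset.mem_univ _)
        have hi' : ∑ j, extensionSum M p k (j ::ₘ i ::ₘ m ::ₘ s) * p j = 0 := by
          rw [hsucc]
          exact (mul_eq_zero.1 hi).resolve_right (hp i).ne'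
        have hj := (Finset.sum_eq_zero_iff_of_nonneg
          (fun j _ => mul_nonneg (hnn _ _) (hp j).le)).1 hi' j (Finset.mem_univ _)
        rw [(mul_eq_zero.1 hj).resolve_right (hp j).ne', zero_mul]
      · rwa [le_div_iff₀ hpos]

/-- Log-concavity of the independent set polynomial, in differential form. -/
lemma extensionSum_mul_hessian_le (hp : ∀ i, 0 < p i) (k : ℕ) (s : Multiset α) (v : α → ℝ) :
    (∑ i, v i * ∑ j, v j * extensionSum M p k (j ::ₘ i ::ₘ s)) * extensionSum M p (k + 2) s ≤
      (∑ i, v i * extensionSum M p (k + 1) (i ::ₘ s)) ^ 2 := by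
  have h := reverse_cauchySchwarz (fun i j => extensionSum M p k (j ::ₘ i ::ₘ s))
    (fun i j => by rw [Multiset.cons_swap]) (fun i j => extensionSum_nonneg (fun i => (hp i).le) _ _)
    p hp (extensionSum_hessian_nonpos hp k s) v
  simp only [mul_comm (extensionSum M p k _)] at h
  exact h

/-- A nonnegative log-concave function on `[0, 1]` with a critical point at `0` is maximal there. -/
lemma le_of_log_concave_of_critical {f f' f'' : ℝ → ℝ} (hf : ∀ t, HasDerivAt f (f' t) t)
    (hf' : ∀ t, HasDerivAt f' (f'' t) t) (hpos : ∀ t ∈ Set.Ico (0 : ℝ) 1, 0 < f t)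
    (hlc : ∀ t ∈ Set.Ico (0 : ℝ) 1, f'' t * f t ≤ f' t ^ 2) (h0 : f' 0 = 0) : f 1 ≤ f 0 := by
  have hanti : AntitoneOn (fun t => f' t / f t) (Set.Ico 0 1) := by
    have hd : ∀ t ∈ Set.Ico (0 : ℝ) 1, HasDerivAt (fun t => f' t / f t)
        ((f'' t * f t - f' t * f' t) / f t ^ 2) t := fun t ht =>
      (hf' t).fun_div (hf t) (hpos t ht).ne'
    refine antitoneOn_of_deriv_nonpos (convex_Ico 0 1)
      (fun t ht => (hd t ht).continuousAt.continuousWithinAt)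
      (fun t ht => (hd t (interior_subset ht)).differentiableAt.differentiableWithinAt)
      fun t ht => ?_
    have ht' := interior_subset ht
    rw [(hd t ht').deriv]
    exact div_nonpos_of_nonpos_of_nonneg (by nlinarith [hlc t ht']) (sq_nonneg _)
  have hneg : ∀ t ∈ Set.Ico (0 : ℝ) 1, f' t ≤ 0 := by
    intro t ht
    have h := hanti (Set.left_mem_Ico.2 one_pos) ht ht.1
    simp only [h0, zero_div] at h
    rwa [div_le_iff₀ (hpos t ht), zero_mul] at h
  have hf_anti : AntitoneOn f (Set.Icc 0 1) := by
    refine antitoneOn_of_deriv_nonpos (convex_Icc 0 1)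
      (fun t _ => (hf t).continuousAt.continuousWithinAt)
      (fun t _ => (hf t).differentiableAt.differentiableWithinAt) fun t ht => ?_
    rw [interior_Icc] at ht
    rw [(hf t).deriv]
    exact hneg t ⟨ht.1.le, ht.2⟩
  exact hf_anti (Set.left_mem_Icc.2 zero_le_one) (Set.right_mem_Icc.2 zero_le_one) zero_le_one

end LogConcavity

/-- **Uniform optimality for transitive matroids.** If the automorphism group of `M`
acts transitively on the ground set and `1 ≤ K ≤ rank M`, then the uniform
distribution `u` maximizes `F_{M,K}` over probability distributions on the ground set. -/
theorem indepProb_le_uniform_of_transitive {α : Type*} [Fintype α] (M : Matroid α)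
    (hE : M.E = Set.univ) (K : ℕ) (hK : 1 ≤ K)
    (hrank : ∃ I : Finset α, M.Indep (I : Set α) ∧ I.card = K)
    (htrans : ∀ e e' : α, ∃ g : α ≃ α,
      (∀ S : Set α, M.Indep (g '' S) ↔ M.Indep S) ∧ g e = e')
    (p : α → ℝ) (hp0 : ∀ e, 0 ≤ p e) (hp1 : ∑ e, p e = 1) :
    indepProb M K p ≤ indepProb M K (fun _ => (Fintype.card α : ℝ)⁻¹) := by
  rw [indepProb_eq_extensionSum, indepProb_eq_extensionSum]
  obtain ⟨I, hI, hIK⟩ := hrank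
  obtain ⟨e₀, -⟩ : I.Nonempty := Finset.card_pos.1 (by omega)
  have hcard : 0 < (Fintype.card α : ℝ) := Nat.cast_pos.2 (Fintype.card_pos_iff.2 ⟨e₀⟩)
  set u := (Fintype.card α : ℝ)⁻¹
  have hu : 0 < u := inv_pos.2 hcard
  have husum : ∑ _e : α, u = 1 := by
    rw [Finset.sum_const, Finset.card_univ, nsmul_eq_mul]
    exact mul_inv_cancel₀ hcard.ne'
  have hgrad : ∀ k i, extensionSum M (fun _ => u) k (i ::ₘ 0) =
      extensionSum M (fun _ => u) k (e₀ ::ₘ 0) := by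
    intro k i
    obtain ⟨g, hg, rfl⟩ := htrans e₀ i
    simpa using extensionSum_map hg u k (e₀ ::ₘ 0)
  have hI0 : IndepMultiset M (0 : Multiset α) := ⟨Multiset.nodup_zero, by simp⟩
  have hIv : IndepMultiset M I.val := ⟨I.nodup, hI⟩
  rcases K with _ | _ | k
  · omega
  · have hlin : ∀ q : α → ℝ, ∑ i, q i = 1 → extensionSum M q 1 0 =
        extensionSum M (fun _ => u) 0 (e₀ ::ₘ 0) := fun q hq =>
      (Finset.sum_congr rfl fun i _ => congrArg (q i * ·) (hgrad 0 i)).trans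
        (by rw [← Finset.sum_mul, hq, one_mul])
    exact ((hlin p hp1).trans (hlin _ husum).symm).le
  let v : α → ℝ := fun i => p i - u
  have hpath : ∀ t ∈ Set.Ico (0 : ℝ) 1, ∀ i, 0 < u + t * v i := by
    intro t ht i
    have h1 := mul_nonneg ht.1 (hp0 i)
    have h2 := mul_pos (sub_pos.2 ht.2) hu
    simp only [v]
    nlinarith
  have hf := hasDerivAt_extensionSum (M := M) (fun _ => u) v (k + 1) 0
  have hf' : ∀ t, HasDerivAt (fun t => ((k + 1 : ℕ) + 1 : ℝ) *
      ∑ i, v i * extensionSum M (fun i => u + t * v i) (k + 1) (i ::ₘ 0))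
      (((k + 1 : ℕ) + 1) * ∑ i, v i * ((k + 1) * ∑ j, v j *
        extensionSum M (fun i => u + t * v i) k (j ::ₘ i ::ₘ 0))) t := fun t =>
    (HasDerivAt.fun_sum fun i _ =>
      (hasDerivAt_extensionSum (fun _ => u) v k (i ::ₘ 0) t).const_mul (v i)).const_mul _
  have key := le_of_log_concave_of_critical hf hf'
    (fun t ht => extensionSum_pos (hpath t ht) hI0 hIv (by simpa using hIK))
    (fun t ht => ?_) ?_
  · simpa [v] using key
  · have h := extensionSum_mul_hessian_le (M := M) (hpath t ht) k 0 v
    have hpos := extensionSum_pos (hpath t ht) hI0 hIv (k := k + 2) (by simpa using hIK)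
    simp only [mul_left_comm (v _) ((k : ℝ) + 1), ← Finset.mul_sum]
    have hsq := sq_nonneg (∑ i, v i * extensionSum M (fun i => u + t * v i) (k + 1) (i ::ₘ 0))
    have hk : (0 : ℝ) ≤ k := k.cast_nonneg
    push_cast
    calc _ = ((k : ℝ) + 1 + 1) * (k + 1) * ((∑ i, v i * ∑ j, v j *
          extensionSum M (fun i => u + t * v i) k (j ::ₘ i ::ₘ 0)) *
          extensionSum M (fun i => u + t * v i) (k + 2) 0) := by ring_nf
      _ ≤ ((k : ℝ) + 1 + 1) * (k + 1) * _ := mul_le_mul_of_nonneg_left h (by positivity)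
      _ ≤ ((k : ℝ) + 1 + 1) * (k + 1 + 1) * _ :=
        mul_le_mul_of_nonneg_right (by nlinarith) hsq
      _ = _ := by ring
  · simp only [zero_mul, add_zero, hgrad, ← Finset.sum_mul]
    simp only [v, Finset.sum_sub_distrib, hp1, husum, sub_self, zero_mul, mul_zero]
end

section
/- Let m ≥ 2, E = A ⊔ B with |A| = |B| = m, and let M be the rank-2 matroid on E whose independent 2-sets are exactly the pairs {a, b} with a ∈ A, b ∈ B. Then the uniform distribution u on E maximizes F_{M,2} over the probability simplex, but it is not the unique maximizer: there exists a probability distribution p ≠ u with F_{M,2}(p) = F_{M,2}(u). Consequently, there is no constant c > 0 such that F_{M,2}(u) − F_{M,2}(p) ≥ c·‖p − u‖_2² for all probability distributions p on E. -/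
open Finset Classical

/-- The rank-2 matroid on `E = A ⊔ B` (with `A = B = Fin m`) whose independent sets are
the sets meeting each of `A` and `B` in at most one element (and of size at most 2). -/
def parallelIndep (m : ℕ) (S : Finset (Fin m ⊕ Fin m)) : Prop :=
  (S.filter (fun x => x.isLeft)).card ≤ 1 ∧
  (S.filter (fun x => x.isRight)).card ≤ 1 ∧ S.card ≤ 2

/-- `F_{M,2}(p) = 2! · ∑_{S ∈ I(M), |S| = 2} ∏_{e ∈ S} p_e` for the parallel-classes
matroid. -/
noncomputable def parallelF (m : ℕ) (p : Fin m ⊕ Fin m → ℝ) : ℝ :=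
  (Nat.factorial 2 : ℝ) *
    ∑ S ∈ Finset.univ.powersetCard 2, if parallelIndep m S then ∏ e ∈ S, p e else 0

/-- The independent sets of size two are exactly the pairs `{inl i, inr j}`. -/
lemma parallelIndep_and_card_eq_two_iff (m : ℕ) (S : Finset (Fin m ⊕ Fin m)) :
    S.card = 2 ∧ parallelIndep m S ↔ ∃ i j, S = {Sum.inl i, Sum.inr j} := by
  constructor
  · rintro ⟨hS, hl, hr, -⟩
    obtain ⟨x, y, hxy, rfl⟩ := card_eq_two.mp hS
    rcases x with i | i <;> rcases y with j | j
    · rw [filter_true_of_mem (by simp), hS] at hl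
      omega
    · exact ⟨i, j, rfl⟩
    · exact ⟨j, i, pair_comm _ _⟩
    · rw [filter_true_of_mem (by simp), hS] at hr
      omega
  · rintro ⟨i, j, rfl⟩
    simp [parallelIndep, filter_insert, filter_singleton]

lemma parallelF_eq_two_mul_sum_mul_sum (m : ℕ) (p : Fin m ⊕ Fin m → ℝ) :
    parallelF m p = 2 * ((∑ i, p (Sum.inl i)) * ∑ j, p (Sum.inr j)) := by
  rw [parallelF, Nat.factorial_two, Nat.cast_ofNat, ← sum_filter, Fintype.sum_mul_sum,
    ← Fintype.sum_prod_type']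
  congr 1
  symm
  refine sum_bij (fun x _ => {Sum.inl x.1, Sum.inr x.2}) ?_ ?_ ?_ ?_
  · intro x _
    rw [mem_filter, mem_powersetCard_univ, parallelIndep_and_card_eq_two_iff]
    exact ⟨_, _, rfl⟩
  · rintro ⟨i, j⟩ _ ⟨k, l⟩ _ h
    have hi : Sum.inl i ∈ ({Sum.inl k, Sum.inr l} : Finset (Fin m ⊕ Fin m)) := by
      rw [← h]; simp
    have hj : Sum.inr j ∈ ({Sum.inl k, Sum.inr l} : Finset (Fin m ⊕ Fin m)) := by
      rw [← h]; simp
    simp_all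
  · intro S hS
    rw [mem_filter, mem_powersetCard_univ, parallelIndep_and_card_eq_two_iff] at hS
    obtain ⟨i, j, rfl⟩ := hS
    exact ⟨(i, j), mem_univ _, rfl⟩
  · intro x _
    rw [prod_pair (by simp)]

lemma parallelF_le_half (m : ℕ) (p : Fin m ⊕ Fin m → ℝ) (hp : ∑ e, p e = 1) :
    parallelF m p ≤ 1 / 2 := by
  rw [Fintype.sum_sum_type] at hp
  rw [parallelF_eq_two_mul_sum_mul_sum, eq_sub_of_add_eq hp]
  nlinarith [sq_nonneg (2 * ∑ j, p (Sum.inr j) - 1)]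

lemma parallelF_uniform (m : ℕ) (hm : m ≠ 0) :
    parallelF m (fun _ => ((2 * m : ℕ) : ℝ)⁻¹) = 1 / 2 := by
  rw [parallelF_eq_two_mul_sum_mul_sum]
  have : (m : ℝ) ≠ 0 := by exact_mod_cast hm
  simp only [sum_const, card_univ, Fintype.card_fin, nsmul_eq_mul]
  push_cast
  field_simp

/-- Putting mass `1 / 2` on a single element of each parallel class also maximizes `F`. -/
lemma exists_ne_uniform_parallelF_eq (m : ℕ) (hm : 2 ≤ m) :
    ∃ p : Fin m ⊕ Fin m → ℝ, (∀ e, 0 ≤ p e) ∧ (∑ e, p e = 1) ∧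
      p ≠ (fun _ => ((2 * m : ℕ) : ℝ)⁻¹) ∧
      parallelF m p = parallelF m (fun _ => ((2 * m : ℕ) : ℝ)⁻¹) := by
  let q : Fin m → ℝ := Pi.single ⟨0, by omega⟩ (1 / 2)
  have hq : ∑ i, q i = 1 / 2 := by simp [q]
  have hq0 : 0 ≤ q := Pi.single_nonneg.mpr (by norm_num)
  refine ⟨Sum.elim q q, ?_, ?_, ?_, ?_⟩
  · rintro (i | i) <;> exact hq0 i
  · simp only [Fintype.sum_sum_type, Sum.elim_inl, Sum.elim_inr, hq]
    norm_num
  · intro h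
    have h1 := congrFun h (Sum.inl ⟨1, by omega⟩)
    simp [q] at h1
    omega
  · rw [parallelF_uniform m (by omega), parallelF_eq_two_mul_sum_mul_sum]
    simp only [Sum.elim_inl, Sum.elim_inr, hq]
    norm_num

/-- **A transitive matroid with nonunique maximizers.** The uniform distribution `u`
maximizes `F_{M,2}` for the parallel-classes matroid, but it is not the unique
maximizer, and consequently no global quadratic stability inequality can hold. -/
theorem parallel_matroid_nonunique_maximizer (m : ℕ) (hm : 2 ≤ m) :
    (∀ p : Fin m ⊕ Fin m → ℝ, (∀ e, 0 ≤ p e) → (∑ e, p e = 1) →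
        parallelF m p ≤ parallelF m (fun _ => ((2 * m : ℕ) : ℝ)⁻¹)) ∧
    (∃ p : Fin m ⊕ Fin m → ℝ, (∀ e, 0 ≤ p e) ∧ (∑ e, p e = 1) ∧
        p ≠ (fun _ => ((2 * m : ℕ) : ℝ)⁻¹) ∧
        parallelF m p = parallelF m (fun _ => ((2 * m : ℕ) : ℝ)⁻¹)) ∧
    ¬ ∃ c > (0 : ℝ), ∀ p : Fin m ⊕ Fin m → ℝ, (∀ e, 0 ≤ p e) → (∑ e, p e = 1) →
        parallelF m (fun _ => ((2 * m : ℕ) : ℝ)⁻¹) - parallelF m p ≥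
          c * ∑ e, (p e - ((2 * m : ℕ) : ℝ)⁻¹) ^ 2 := by
  refine ⟨fun p _ hp => ?_, exists_ne_uniform_parallelF_eq m hm, ?_⟩
  · rw [parallelF_uniform m (by omega)]
    exact parallelF_le_half m p hp
  · rintro ⟨c, hc, h⟩
    obtain ⟨p, hp0, hp1, hne, heq⟩ := exists_ne_uniform_parallelF_eq m hm
    obtain ⟨e, he⟩ := Function.ne_iff.mp hne
    have hpos : 0 < ∑ e, (p e - ((2 * m : ℕ) : ℝ)⁻¹) ^ 2 :=
      sum_pos' (fun _ _ => sq_nonneg _) ⟨e, mem_univ e, sq_pos_of_ne_zero (sub_ne_zero.mpr he)⟩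
    have hle := h p hp0 hp1
    rw [heq, sub_self] at hle
    exact absurd hle (not_le.mpr (mul_pos hc hpos))
end
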